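/- arXiv:2410.02021 — 5 statements merged into one kernel-verified Lean document; each statement's English description precedes it below -/
import Mathlib

section
/- Let G be the 2-edge-connected graph with vertex set V = {a,b,c,d,t} and edge set E = {{a,c},{c,b},{b,d},{d,a},{a,t},{b,t}}. Then no routing scheme for destination t in which every node of V ∖ {t} uses a link-circular forwarding function is 1-resilient against dynamic failures. -/
namespace FRR

open scoped Classical

variable {V : Type*} [Fintype V] [DecidableEq V]

/-- `G` is `k`-edge-connected: removing any set of at most `k-1` edges keeps it connected. -/
def EdgeConnected (G : SimpleGraph V) (k : ℕ) : Prop :=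
  ∀ F : Set (Sym2 V), F ⊆ G.edgeSet → F.ncard ≤ k - 1 → (G.deleteEdges F).Connected


/-- A (basic, deterministic) forwarding scheme on `G`: given the current node, the
in-port (the neighbor the packet arrived from, `none` for a freshly originated packet)
and the set of currently active neighbors, it selects an active neighbor to forward to. -/
structure FwdScheme (G : SimpleGraph V) where
  fwd : V → Option V → Set V → V
  mem : ∀ (v : V) (ip : Option V) (A : Set V), A.Nonempty → fwd v ip A ∈ A

/-- The packet trajectory (current node, in-port) of a forwarding scheme with
destination `t`, started at `s`, under the failure schedule `σ`; the packet is
absorbed at `t` and gets stuck when no incident link is active. -/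
noncomputable def FwdScheme.traj {G : SimpleGraph V} (P : FwdScheme G)
    (σ : ℕ → Set (Sym2 V)) (t s : V) : ℕ → V × Option V
  | 0 => (s, none)
  | n + 1 =>
    let p := FwdScheme.traj P σ t s n
    if p.1 = t then p
    else if ({u : V | G.Adj p.1 u ∧ s(p.1, u) ∉ σ n} : Set V).Nonempty then
      (P.fwd p.1 p.2 {u : V | G.Adj p.1 u ∧ s(p.1, u) ∉ σ n}, some p.1)
    else p

/-- A forwarding scheme for destination `t` is `r`-resilient against dynamic failures:
for every unstable-link set `F` with `|F| ≤ r`, every (dynamic, i.e. arbitrary) failure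
schedule `σ` on `F` whose induced trajectory satisfies the non-trap assumption, and
every source `s` connected to `t` in `G ∖ F`, the packet reaches `t` in finitely
many steps. -/
def DynResilient {G : SimpleGraph V} (P : FwdScheme G) (t : V) (r : ℕ) : Prop :=
  ∀ F : Set (Sym2 V), F ⊆ G.edgeSet → F.ncard ≤ r →
    ∀ σ : ℕ → Set (Sym2 V), (∀ n, σ n ⊆ F) →
      ∀ s : V,
        (∀ n, (G.deleteEdges F).Reachable (P.traj σ t s n).1 (P.traj σ t s (n + 1)).1) →
        (G.deleteEdges F).Reachable s t →
        ∃ n, (P.traj σ t s n).1 = t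

/-- The forwarding function `f` at node `v` is link-circular: there is a cyclic order
`c` of the neighbors of `v` (a permutation of `V` fixing non-neighbors, mapping
neighbors to neighbors and acting transitively on them) such that a packet arriving
from neighbor `u` is forwarded to the first neighbor after `u` in the cyclic order
whose connecting link is active. -/
def IsLinkCircular (G : SimpleGraph V) (v : V) (f : Option V → Set V → V) : Prop :=
  ∃ c : Equiv.Perm V,
    (∀ x, x ∉ G.neighborSet v → c x = x) ∧
    (∀ x, x ∈ G.neighborSet v → c x ∈ G.neighborSet v) ∧
    (∀ x ∈ G.neighborSet v, ∀ y ∈ G.neighborSet v, ∃ n : ℕ, (c ^ n) x = y) ∧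
    (∀ u ∈ G.neighborSet v, ∀ A : Set V, A ⊆ G.neighborSet v → A.Nonempty →
      ∃ n : ℕ, 0 < n ∧ (c ^ n) u ∈ A ∧ (∀ m : ℕ, 0 < m → m < n → (c ^ m) u ∉ A) ∧
        f (some u) A = (c ^ n) u)

/-- The graph of Fig. 1: vertices `a = 0, b = 1, c = 2, d = 3, t = 4`, with edges
`{a,c}, {c,b}, {b,d}, {d,a}, {a,t}, {b,t}`. -/
def G5 : SimpleGraph (Fin 5) :=
  SimpleGraph.fromEdgeSet {s(0, 2), s(2, 1), s(1, 3), s(3, 0), s(0, 4), s(1, 4)}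

lemma conn_of {H : SimpleGraph (Fin 5)} (h0 : H.Reachable 0 4) (h1 : H.Reachable 1 4)
    (h2 : H.Reachable 2 4) (h3 : H.Reachable 3 4) : H.Connected := by
  have h : ∀ x, H.Reachable x 4 := by
    intro x
    fin_cases x
    · exact h0
    · exact h1
    · exact h2
    · exact h3
    · exact SimpleGraph.Reachable.refl _
  exact ⟨fun x y => (h x).trans (h y).symm⟩

lemma g5_conn (F : Set (Sym2 (Fin 5))) (hF : F ⊆ G5.edgeSet) (hc : F.ncard ≤ 1) :
    (G5.deleteEdges F).Connected := by
  have hs : ∀ x ∈ F, ∀ y ∈ F, x = y := fun x hx y hy =>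
    (Set.ncard_le_one (Set.toFinite F)).1 hc x hx y hy
  have key : ∃ e ∈ G5.edgeSet, F ⊆ {e} := by
    by_cases hne : F.Nonempty
    · obtain ⟨e, he⟩ := hne
      exact ⟨e, hF he, fun x hx => hs x hx e he⟩
    · rw [Set.not_nonempty_iff_eq_empty] at hne
      refine ⟨s(0, 2), by simp [G5], by simp [hne]⟩
  obtain ⟨e, he, hFe⟩ := key
  refine SimpleGraph.Connected.mono (SimpleGraph.deleteEdges_anti hFe) ?_
  have he' : e = s(0, 2) ∨ e = s(2, 1) ∨ e = s(1, 3) ∨ e = s(3, 0) ∨ e = s(0, 4) ∨ e = s(1, 4) := by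
    have := he
    simp only [G5, SimpleGraph.edgeSet_fromEdgeSet] at this
    simpa using this.1
  have adj : ∀ u v, G5.Adj u v → s(u, v) ≠ e → (G5.deleteEdges {e}).Reachable u v := by
    intro u v h1 h2
    apply SimpleGraph.Adj.reachable
    rw [SimpleGraph.deleteEdges_adj]
    exact ⟨h1, by simpa using h2⟩
  have a04 : G5.Adj 0 4 := by simp [G5]
  have a14 : G5.Adj 1 4 := by simp [G5]
  have a20 : G5.Adj 2 0 := by simp [G5]
  have a21 : G5.Adj 2 1 := by simp [G5]
  have a30 : G5.Adj 3 0 := by simp [G5]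
  have a31 : G5.Adj 3 1 := by simp [G5]
  have r04 := adj _ _ a04
  have r14 := adj _ _ a14
  have r20 := adj _ _ a20
  have r21 := adj _ _ a21
  have r30 := adj _ _ a30
  have r31 := adj _ _ a31
  have r02 := adj _ _ a20.symm
  have r12 := adj _ _ a21.symm
  clear adj hFe he
  rcases he' with rfl | rfl | rfl | rfl | rfl | rfl
  · have r04 := r04 (by decide)
    have r14 := r14 (by decide)
    exact conn_of r04 r14 ((r21 (by decide)).trans r14) ((r31 (by decide)).trans r14)
  · have r04 := r04 (by decide)
    have r14 := r14 (by decide)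
    exact conn_of r04 r14 ((r20 (by decide)).trans r04) ((r31 (by decide)).trans r14)
  · have r04 := r04 (by decide)
    have r14 := r14 (by decide)
    exact conn_of r04 r14 ((r20 (by decide)).trans r04) ((r30 (by decide)).trans r04)
  · have r04 := r04 (by decide)
    have r14 := r14 (by decide)
    exact conn_of r04 r14 ((r20 (by decide)).trans r04) ((r31 (by decide)).trans r14)
  · have r14 := r14 (by decide)
    have r24 := (r21 (by decide)).trans r14
    exact conn_of ((r02 (by decide)).trans r24) r14 r24 ((r31 (by decide)).trans r14)
  · have r04 := r04 (by decide)
    have r24 := (r20 (by decide)).trans r04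
    exact conn_of r04 ((r12 (by decide)).trans r24) r24 ((r30 (by decide)).trans r04)

/-- A link-circular function bounces only when no other link is active. -/
lemma lc_ne {G : SimpleGraph (Fin 5)} {v : Fin 5} {f : Option (Fin 5) → Set (Fin 5) → Fin 5}
    (h : IsLinkCircular G v f) {u w : Fin 5} {A : Set (Fin 5)} (hu : G.Adj v u)
    (hA : ∀ x ∈ A, G.Adj v x) (hw : w ∈ A) (hwu : w ≠ u) : f (some u) A ∈ A ∧ f (some u) A ≠ u := by
  obtain ⟨c, -, -, h3, h4⟩ := h
  obtain ⟨n, hn, hnA, hmin, hf⟩ := h4 u hu A hA ⟨w, hw⟩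
  refine ⟨hf ▸ hnA, ?_⟩
  rw [hf]
  intro hcu
  obtain ⟨k, hk⟩ := h3 u hu w (hA w hw)
  have hmod : (c ^ (k % n)) u = w := by
    have e1 : ∀ j : ℕ, ((c ^ n) ^ j) u = u := by
      intro j
      induction j with
      | zero => rfl
      | succ j ih => rw [pow_succ, Equiv.Perm.mul_apply, hcu, ih]
    rw [← Nat.mod_add_div k n, pow_add, Equiv.Perm.mul_apply, pow_mul, e1] at hk
    exact hk
  rcases Nat.eq_zero_or_pos (k % n) with h0 | h0
  · rw [h0] at hmod
    exact hwu hmod.symm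
  · exact hmin _ h0 (Nat.mod_lt _ hn) (hmod ▸ hw)

/-- With exactly two active links the packet takes the other one. -/
lemma lc_two {G : SimpleGraph (Fin 5)} {v : Fin 5} {f : Option (Fin 5) → Set (Fin 5) → Fin 5}
    (h : IsLinkCircular G v f) {u w : Fin 5} (hu : G.Adj v u)
    (hw : G.Adj v w) (hwu : w ≠ u) : f (some u) {u, w} = w := by
  have := lc_ne h (A := {u, w}) hu (by rintro x (rfl | rfl) <;> assumption) (by simp) hwu
  rcases this with ⟨h1 | h1, h2⟩
  · exact absurd h1 h2
  · exact h1

/-- At a node of degree three with neighbors `2, 3, 4`, one of the two turns avoids `4`. -/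
lemma lc_three {G : SimpleGraph (Fin 5)} {v : Fin 5} {f : Option (Fin 5) → Set (Fin 5) → Fin 5}
    (h : IsLinkCircular G v f) (hN : ∀ x, G.Adj v x ↔ x ∈ ({2, 3, 4} : Set (Fin 5))) :
    f (some 2) {2, 3, 4} = 3 ∨ f (some 3) {2, 3, 4} = 2 := by
  have n2 := lc_ne h (u := 2) (w := 3) (A := {2, 3, 4}) ((hN 2).2 (by simp))
    (fun x hx => (hN x).2 hx) (by simp) (by decide)
  have n3 := lc_ne h (u := 3) (w := 2) (A := {2, 3, 4}) ((hN 3).2 (by simp))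
    (fun x hx => (hN x).2 hx) (by simp) (by decide)
  obtain ⟨c, -, h2, -, h4⟩ := h
  have hc : ∀ u ∈ ({2, 3, 4} : Set (Fin 5)), f (some u) {2, 3, 4} = c u := by
    intro u hu
    have hu' := (hN u).2 hu
    obtain ⟨n, hn, hnA, hmin, hf⟩ := h4 u hu' {2, 3, 4} (fun x hx => (hN x).2 hx) ⟨2, by simp⟩
    have : n = 1 := by
      by_contra hne
      exact hmin 1 one_pos (by omega) ((hN _).1 (by simpa using h2 u hu'))
    rw [hf, this, pow_one]
  rw [hc 2 (by simp)] at n2 ⊢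
  rw [hc 3 (by simp)] at n3 ⊢
  have inj : c 2 ≠ c 3 := fun hh => absurd (c.injective hh) (by decide)
  simp only [Set.mem_insert_iff, Set.mem_singleton_iff] at n2 n3
  by_contra hcon
  push Not at hcon
  have e2 : c 2 = 4 := by tauto
  have e3 : c 3 = 4 := by tauto
  exact inj (e2.trans e3.symm)

lemma traj_step (P : FwdScheme G5) (σ : ℕ → Set (Sym2 (Fin 5))) (s : Fin 5) (n : ℕ)
    (v : Fin 5) (ip : Option (Fin 5)) (w : Fin 5) (A : Set (Fin 5)) (hv : v ≠ 4)
    (hn : P.traj σ 4 s n = (v, ip)) (hA : {u | G5.Adj v u ∧ s(v, u) ∉ σ n} = A)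
    (hne : A.Nonempty) (hw : P.fwd v ip A = w) : P.traj σ 4 s (n + 1) = (w, some v) := by
  subst hA
  simp only [FwdScheme.traj, hn]
  rw [if_neg hv, if_pos hne, hw]

/-- If the packet enters a forwarding loop avoiding `4`, the scheme is not resilient. -/
lemma not_res (P : FwdScheme G5) (e : Sym2 (Fin 5)) (he : e ∈ G5.edgeSet)
    (S0 S : Set (Sym2 (Fin 5))) (hS0 : S0 ⊆ {e}) (hS : S ⊆ {e})
    (x p y q : Fin 5) (hx : x ≠ 4) (hp : p ≠ 4) (hy : y ≠ 4) (hq : q ≠ 4)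
    (A0 Ax Ap Ay Aq : Set (Fin 5))
    (h0 : {u | G5.Adj x u ∧ s(x, u) ∉ S0} = A0)
    (h1 : {u | G5.Adj x u ∧ s(x, u) ∉ S} = Ax)
    (h2 : {u | G5.Adj p u ∧ s(p, u) ∉ S} = Ap)
    (h3 : {u | G5.Adj y u ∧ s(y, u) ∉ S} = Ay)
    (h4 : {u | G5.Adj q u ∧ s(q, u) ∉ S} = Aq)
    (m0 : p ∈ A0) (m1 : p ∈ Ax) (m2 : y ∈ Ap) (m3 : q ∈ Ay) (m4 : x ∈ Aq)
    (f0 : P.fwd x none A0 = p) (f1 : P.fwd x (some q) Ax = p) (f2 : P.fwd p (some x) Ap = y)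
    (f3 : P.fwd y (some p) Ay = q) (f4 : P.fwd q (some y) Aq = x) :
    ¬ DynResilient P 4 1 := by
  intro hres
  let σ : ℕ → Set (Sym2 (Fin 5)) := fun n => if n = 0 then S0 else S
  have hc := g5_conn {e} (by simpa using he) (by simp)
  obtain ⟨n, hn⟩ := hres {e} (by simpa using he) (by simp) σ
    (by intro n; by_cases h : n = 0 <;> simp [σ, h, hS0, hS]) x
    (fun n => hc.preconnected _ _) (hc.preconnected _ _)
  have inv : ∀ n, P.traj σ 4 x (n + 1) = (p, some x) ∨ P.traj σ 4 x (n + 1) = (y, some p) ∨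
      P.traj σ 4 x (n + 1) = (q, some y) ∨ P.traj σ 4 x (n + 1) = (x, some q) := by
    intro n
    induction n with
    | zero => exact Or.inl (traj_step P σ x 0 x none p A0 hx rfl h0 ⟨p, m0⟩ f0)
    | succ n ih =>
      have hs : σ (n + 1) = S := by simp [σ]
      rcases ih with h | h | h | h
      · exact Or.inr (Or.inl (traj_step P σ x _ p _ y Ap hp h (by rw [hs, h2]) ⟨_, m2⟩ f2))
      · exact Or.inr (Or.inr (Or.inl
          (traj_step P σ x _ y _ q Ay hy h (by rw [hs, h3]) ⟨_, m3⟩ f3)))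
      · exact Or.inr (Or.inr (Or.inr
          (traj_step P σ x _ q _ x Aq hq h (by rw [hs, h4]) ⟨_, m4⟩ f4)))
      · exact Or.inl (traj_step P σ x _ x _ p Ax hx h (by rw [hs, h1]) ⟨_, m1⟩ f1)
  cases n with
  | zero => exact hx hn
  | succ n =>
    rcases inv n with h | h | h | h <;> rw [h] at hn
    · exact hp hn
    · exact hy hn
    · exact hq hn
    · exact hx hn

lemma adj0 (x : Fin 5) : G5.Adj 0 x ↔ x ∈ ({2, 3, 4} : Set (Fin 5)) := by
  fin_cases x <;> simp [G5]
lemma adj1 (x : Fin 5) : G5.Adj 1 x ↔ x ∈ ({2, 3, 4} : Set (Fin 5)) := by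
  fin_cases x <;> simp [G5]
lemma adj2 (x : Fin 5) : G5.Adj 2 x ↔ x ∈ ({0, 1} : Set (Fin 5)) := by
  fin_cases x <;> simp [G5]
lemma adj3 (x : Fin 5) : G5.Adj 3 x ↔ x ∈ ({0, 1} : Set (Fin 5)) := by
  fin_cases x <;> simp [G5]

/-- Theorem (no 1-resilience with link-circular routing): the graph `G5` is
2-edge-connected, yet no routing scheme for destination `t = 4` in which every node
other than `t` uses a link-circular forwarding function is 1-resilient against
dynamic failures. -/
theorem no_one_resilient_link_circular :
    EdgeConnected G5 2 ∧
    ∀ P : FwdScheme G5,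
      (∀ v : Fin 5, v ≠ 4 → IsLinkCircular G5 v (P.fwd v)) →
      ¬ DynResilient P (4 : Fin 5) 1 := by
  refine ⟨fun F hF hc => g5_conn F hF (by simpa using hc), ?_⟩
  intro P hP
  have c0 := hP 0 (by decide)
  have c1 := hP 1 (by decide)
  have c2 := hP 2 (by decide)
  have c3 := hP 3 (by decide)
  -- two-port facts
  have a23 : P.fwd 0 (some 2) {2, 3} = 3 := lc_two c0 (by simp [G5]) (by simp [G5]) (by decide)
  have a32 : P.fwd 0 (some 3) {2, 3} = 2 := by
    rw [Set.pair_comm]; exact lc_two c0 (by simp [G5]) (by simp [G5]) (by decide)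
  have b23 : P.fwd 1 (some 2) {2, 3} = 3 := lc_two c1 (by simp [G5]) (by simp [G5]) (by decide)
  have b32 : P.fwd 1 (some 3) {2, 3} = 2 := by
    rw [Set.pair_comm]; exact lc_two c1 (by simp [G5]) (by simp [G5]) (by decide)
  have c01 : P.fwd 2 (some 0) {0, 1} = 1 := lc_two c2 (by simp [G5]) (by simp [G5]) (by decide)
  have c10 : P.fwd 2 (some 1) {0, 1} = 0 := by
    rw [Set.pair_comm]; exact lc_two c2 (by simp [G5]) (by simp [G5]) (by decide)
  have d01 : P.fwd 3 (some 0) {0, 1} = 1 := lc_two c3 (by simp [G5]) (by simp [G5]) (by decide)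
  have d10 : P.fwd 3 (some 1) {0, 1} = 0 := by
    rw [Set.pair_comm]; exact lc_two c3 (by simp [G5]) (by simp [G5]) (by decide)
  have o2 : P.fwd 2 none {0, 1} = 0 ∨ P.fwd 2 none {0, 1} = 1 := P.mem 2 none {0, 1} ⟨0, by simp⟩
  have o3 : P.fwd 3 none {0, 1} = 0 ∨ P.fwd 3 none {0, 1} = 1 := P.mem 3 none {0, 1} ⟨0, by simp⟩
  have s2 : P.fwd 2 none {0} = 0 := P.mem 2 none {0} ⟨0, by simp⟩
  have s3 : P.fwd 3 none {0} = 0 := P.mem 3 none {0} ⟨0, by simp⟩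
  rcases lc_three c0 adj0 with ha | ha <;> rcases lc_three c1 adj1 with hb | hb
  · -- both turn from `2` to `3`
    rcases o2 with o | o
    · refine not_res P s(1, 4) (by simp [G5]) {s(1, 4)} {s(1, 4)} subset_rfl subset_rfl 2 0 3 1
        (by decide) (by decide) (by decide) (by decide)
        {0, 1} {0, 1} {2, 3, 4} {0, 1} {2, 3} ?_ ?_ ?_ ?_ ?_ (by simp) (by simp) (by simp)
        (by simp) (by simp) o c10 ha d01 b32 <;>
      (ext x; fin_cases x <;> simp [adj0, adj1, adj2, adj3])
    · refine not_res P s(0, 4) (by simp [G5]) {s(0, 4)} {s(0, 4)} subset_rfl subset_rfl 2 1 3 0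
        (by decide) (by decide) (by decide) (by decide)
        {0, 1} {0, 1} {2, 3, 4} {0, 1} {2, 3} ?_ ?_ ?_ ?_ ?_ (by simp) (by simp) (by simp)
        (by simp) (by simp) o c01 hb d10 a32 <;>
      (ext x; fin_cases x <;> simp [adj0, adj1, adj2, adj3])
  · refine not_res P s(2, 1) (by simp [G5]) {s(2, 1)} ∅ subset_rfl (by simp) 2 0 3 1
        (by decide) (by decide) (by decide) (by decide)
        {0} {0, 1} {2, 3, 4} {0, 1} {2, 3, 4} ?_ ?_ ?_ ?_ ?_ (by simp) (by simp) (by simp)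
        (by simp) (by simp) s2 c10 ha d01 hb <;>
      (ext x; fin_cases x <;> simp [adj0, adj1, adj2, adj3])
  · refine not_res P s(1, 3) (by simp [G5]) {s(1, 3)} ∅ subset_rfl (by simp) 3 0 2 1
        (by decide) (by decide) (by decide) (by decide)
        {0} {0, 1} {2, 3, 4} {0, 1} {2, 3, 4} ?_ ?_ ?_ ?_ ?_ (by simp) (by simp) (by simp)
        (by simp) (by simp) s3 d10 ha c01 hb <;>
      (ext x; fin_cases x <;> simp [adj0, adj1, adj2, adj3])
  · rcases o3 with o | o
    · refine not_res P s(1, 4) (by simp [G5]) {s(1, 4)} {s(1, 4)} subset_rfl subset_rfl 3 0 2 1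
        (by decide) (by decide) (by decide) (by decide)
        {0, 1} {0, 1} {2, 3, 4} {0, 1} {2, 3} ?_ ?_ ?_ ?_ ?_ (by simp) (by simp) (by simp)
        (by simp) (by simp) o d10 ha c01 b23 <;>
      (ext x; fin_cases x <;> simp [adj0, adj1, adj2, adj3])
    · refine not_res P s(0, 4) (by simp [G5]) {s(0, 4)} {s(0, 4)} subset_rfl subset_rfl 3 1 2 0
        (by decide) (by decide) (by decide) (by decide)
        {0, 1} {0, 1} {2, 3, 4} {0, 1} {2, 3} ?_ ?_ ?_ ?_ ?_ (by simp) (by simp) (by simp)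
        (by simp) (by simp) o d01 hb c10 a23 <;>
      (ext x; fin_cases x <;> simp [adj0, adj1, adj2, adj3])

end FRR
end

section
/- Let G be a finite k-edge-connected undirected graph with destination t ∈ V and let T_1,…,T_k be pairwise arc-disjoint arborescences of G rooted at t. Then the HDR-Log-K-Bits routing process, which stores only the value current_id ∈ {1,…,k} (⌈log₂ k⌉ rewritable bits) in the packet header, is (k−1)-resilient against dynamic failures: for every unstable-link set F with |F| ≤ k−1, every dynamic schedule on F satisfying the non-trap assumption, and every starting node, the packet reaches t after finitely many steps. -/
namespace FRR

open scoped Classical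

variable {V : Type*} [Fintype V] [DecidableEq V]

/-- An arborescence of `G` rooted at `t`, given by a parent map: every node `v ≠ t`
has exactly one outgoing arc `(v, par v)`, and iterating the parent map reaches `t`. -/
structure Arb (G : SimpleGraph V) (t : V) where
  par : V → V
  adj : ∀ v, v ≠ t → G.Adj v (par v)
  reaches : ∀ v, ∃ n : ℕ, par^[n] v = t

/-- The arc `(u, v)` belongs to the arborescence `T`. -/
def Arb.Arc {G : SimpleGraph V} {t : V} (T : Arb G t) (u v : V) : Prop :=
  u ≠ t ∧ T.par u = v

/-- Two arborescences are arc-disjoint: they share no directed arc. -/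
def ArcDisjoint {G : SimpleGraph V} {t : V} (T T' : Arb G t) : Prop :=
  ∀ u v : V, ¬ (T.Arc u v ∧ T'.Arc u v)

/-- The cyclically next index: `(i + 1) mod k`. -/
def nextIdx {k : ℕ} (i : Fin k) : Fin k := ⟨((i : ℕ) + 1) % k, Nat.mod_lt _ i.pos⟩

/-- One step of the HDR-Log-K-Bits process at time `n`. The state is
`(current node, current arborescence index i, header value current_id)`.
Route canonically along `T i`; upon hitting a down outgoing arc `(u, w)`:
if the reversed arc `(w, u)` belongs to some arborescence `T j` with `j ≠ i`, then
if `current_id ≠ i` increment `current_id` (mod `k`) and set `i := current_id`,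
otherwise set `i := j`; if the reversed arc belongs to no arborescence, increment
`current_id` (mod `k`) and set `i := current_id`. -/
noncomputable def hdrLogStep {G : SimpleGraph V} {t : V} {k : ℕ}
    (T : Fin k → Arb G t) (σ : ℕ → Set (Sym2 V)) (n : ℕ)
    (st : V × Fin k × Fin k) : V × Fin k × Fin k :=
  if st.1 = t then st
  else
    let w := (T st.2.1).par st.1
    if s(st.1, w) ∉ σ n then (w, st.2.1, st.2.2)
    else if h : ∃ j : Fin k, j ≠ st.2.1 ∧ (T j).Arc w st.1 then
      if st.2.2 ≠ st.2.1 then (st.1, nextIdx st.2.2, nextIdx st.2.2)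
      else (st.1, h.choose, st.2.2)
    else (st.1, nextIdx st.2.2, nextIdx st.2.2)

/-- The trajectory of the HDR-Log-K-Bits process started at node `s` on
arborescence `i₀`, carrying the header value `current_id` (initially `i₀`). -/
noncomputable def hdrLogTraj {G : SimpleGraph V} {t : V} {k : ℕ}
    (T : Fin k → Arb G t) (σ : ℕ → Set (Sym2 V)) (s : V) (i₀ : Fin k) :
    ℕ → V × Fin k × Fin k
  | 0 => (s, i₀, i₀)
  | n + 1 => hdrLogStep T σ n (hdrLogTraj T σ s i₀ n)

/-- Depth of a node in an arborescence. -/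
noncomputable def Arb.depth {G : SimpleGraph V} {t : V} (T : Arb G t) (v : V) : ℕ :=
  Nat.find (T.reaches v)

theorem Arb.depth_par {G : SimpleGraph V} {t : V} (T : Arb G t) (v : V) (hv : v ≠ t) :
    T.depth (T.par v) < T.depth v := by
  have h1 : T.par^[T.depth v] v = t := Nat.find_spec (T.reaches v)
  obtain ⟨m, hm⟩ : ∃ m, T.depth v = m + 1 := by
    rcases hd : T.depth v with _ | m
    · rw [hd] at h1
      exact absurd h1 hv
    · exact ⟨m, rfl⟩
  rw [hm, Function.iterate_succ_apply] at h1
  have : T.depth (T.par v) ≤ m := Nat.find_min' _ h1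
  omega

/-- There are at most `2 |F|` arcs whose link lies in `F`. -/
theorem card_arcs_le (F : Set (Sym2 V)) :
    (Finset.univ.filter (fun p : V × V => s(p.1, p.2) ∈ F)).card ≤ 2 * F.ncard := by
  rw [Set.ncard_eq_toFinset_card' F]
  apply Finset.card_le_mul_card_image_of_maps_to (f := fun p : V × V => s(p.1, p.2))
  · intro p hp
    simpa using hp
  · intro e _
    induction e using Sym2.ind with
    | _ a b =>
      refine le_trans (Finset.card_le_card (t := {(a, b), (b, a)}) ?_) Finset.card_le_two
      rintro ⟨x, y⟩ hp
      simp only [Finset.mem_filter, Sym2.eq_iff] at hp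
      rcases hp.2 with ⟨rfl, rfl⟩ | ⟨rfl, rfl⟩ <;> simp

/-- Existence of a good arborescence: every bounce from it leads to a clean path. -/
theorem exists_good (G : SimpleGraph V) (t : V) (k : ℕ)
    (T : Fin k → Arb G t)
    (hdisj : ∀ i j : Fin k, i ≠ j → ArcDisjoint (T i) (T j))
    (F : Set (Sym2 V)) (hF : F.ncard < k) :
    ∃ g : Fin k, ∀ u, u ≠ t → s(u, (T g).par u) ∈ F →
      ∃ j, (T j).Arc ((T g).par u) u ∧
        ∀ v, v ≠ t → (T j).depth v < (T j).depth ((T g).par u) → s(v, (T j).par v) ∉ F := by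
  by_contra hcon
  push Not at hcon
  choose b hbt hbF hb using hcon
  have hex : ∀ i, ∃ h, (h ≠ t ∧ s(h, (T i).par h) ∈ F) ∧
      ∀ v, v ≠ t → (T i).depth v < (T i).depth h → s(v, (T i).par v) ∉ F := by
    intro i
    obtain ⟨h, hh, hmin⟩ := Set.exists_min_image
      {v : V | v ≠ t ∧ s(v, (T i).par v) ∈ F} (T i).depth (Set.toFinite _)
      ⟨b i, hbt i, hbF i⟩
    refine ⟨h, hh, fun v hv hlt hvF => ?_⟩
    have := hmin v ⟨hv, hvF⟩
    omega
  choose h hh hmin using hex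
  have harc : ∀ i j u v, u ≠ t → v ≠ t → u = v → (T i).par u = (T j).par v → i = j := by
    intro i j u v hu hv huv hp
    subst huv
    by_contra hne
    exact hdisj i j hne u _ ⟨⟨hu, rfl⟩, ⟨hv, hp.symm⟩⟩
  let f : Fin k ⊕ Fin k → V × V := Sum.elim
    (fun i => ((T i).par (b i), b i)) (fun i => (h i, (T i).par (h i)))
  have hinj : Function.Injective f := by
    have key : ∀ i j, f (Sum.inl i) ≠ f (Sum.inr j) := by
      intro i j hij
      simp only [f, Sum.elim_inl, Sum.elim_inr, Prod.mk.injEq] at hij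
      obtain ⟨v, hv, hlt, hvF⟩ := hb i j ⟨by rw [hij.1]; exact (hh j).1, by rw [hij.1]; exact hij.2.symm⟩
      rw [hij.1] at hlt
      exact hmin j v hv hlt hvF
    rintro (i | i) (j | j) hij
    · simp only [f, Sum.elim_inl, Prod.mk.injEq] at hij
      rw [harc i j _ _ (hbt i) (hbt j) hij.2 hij.1]
    · exact absurd hij (key i j)
    · exact absurd hij.symm (key j i)
    · simp only [f, Sum.elim_inr, Prod.mk.injEq] at hij
      rw [harc i j _ _ (hh i).1 (hh j).1 hij.1 hij.2]
  have hle : (Finset.univ.image f).card ≤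
      (Finset.univ.filter (fun p : V × V => s(p.1, p.2) ∈ F)).card := by
    apply Finset.card_le_card
    intro p hp
    obtain ⟨x, _, rfl⟩ := Finset.mem_image.1 hp
    rcases x with i | i
    · simp only [f, Sum.elim_inl, Finset.mem_filter, Finset.mem_univ, true_and]
      rw [Sym2.eq_swap]
      exact hbF i
    · simpa [f] using (hh i).2
  rw [Finset.card_image_of_injective _ hinj] at hle
  have := card_arcs_le F
  simp only [Finset.card_univ, Fintype.card_sum, Fintype.card_fin] at hle
  omega

/-- Canonical routing continues until `t` or until a down arc is met. -/
theorem canonical {G : SimpleGraph V} {t : V} {k : ℕ} (T : Fin k → Arb G t)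
    (σ : ℕ → Set (Sym2 V)) (s : V) (i₀ : Fin k)
    (hne : ∀ n, (hdrLogTraj T σ s i₀ n).1 ≠ t) (i c : Fin k) :
    ∀ (d n : ℕ) (v : V), (T i).depth v ≤ d → hdrLogTraj T σ s i₀ n = (v, i, c) →
      ∃ m u, hdrLogTraj T σ s i₀ m = (u, i, c) ∧ u ≠ t ∧ (T i).depth u ≤ (T i).depth v ∧
        s(u, (T i).par u) ∈ σ m := by
  intro d
  induction d with
  | zero =>
    intro n v hd hv
    have hvt : v ≠ t := by simpa [hv] using hne n
    have := (T i).depth_par v hvt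
    omega
  | succ d ih =>
    intro n v hd hv
    have hvt : v ≠ t := by simpa [hv] using hne n
    have hlt := (T i).depth_par v hvt
    by_cases hdown : s(v, (T i).par v) ∈ σ n
    · exact ⟨n, v, hv, hvt, le_rfl, hdown⟩
    · have hs : hdrLogTraj T σ s i₀ (n + 1) = ((T i).par v, i, c) := by
        simp [hdrLogTraj, hv, hdrLogStep, hvt, hdown]
      obtain ⟨m, u, h1, h2, h3, h4⟩ := ih (n + 1) _ (by omega) hs
      exact ⟨m, u, h1, h2, by omega, h4⟩

/-- From a state with `i = current_id`, `current_id` is eventually incremented. -/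
theorem phase {G : SimpleGraph V} {t : V} {k : ℕ} (T : Fin k → Arb G t)
    (σ : ℕ → Set (Sym2 V)) (s : V) (i₀ : Fin k)
    (hne : ∀ n, (hdrLogTraj T σ s i₀ n).1 ≠ t) (c : Fin k)
    (hc : ∃ n v, hdrLogTraj T σ s i₀ n = (v, c, c)) :
    ∃ n v, hdrLogTraj T σ s i₀ n = (v, nextIdx c, nextIdx c) := by
  obtain ⟨n, v, hv⟩ := hc
  obtain ⟨m, u, h1, h2, -, h4⟩ := canonical T σ s i₀ hne c c _ n v le_rfl hv
  by_cases h : ∃ j : Fin k, j ≠ c ∧ (T j).Arc ((T c).par u) u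
  · have hs : hdrLogTraj T σ s i₀ (m + 1) = (u, h.choose, c) := by
      rw [hdrLogTraj, h1]
      simp only [hdrLogStep, if_neg h2, h4, not_true_eq_false, if_false, dif_pos h, ne_eq]
    have hjc := h.choose_spec.1
    generalize h.choose = j at hs hjc
    obtain ⟨m', u', h1', h2', -, h4'⟩ := canonical T σ s i₀ hne j c _ _ u le_rfl hs
    refine ⟨m' + 1, u', ?_⟩
    rw [hdrLogTraj, h1']
    simp [hdrLogStep, h2', h4', hjc.symm]
  · refine ⟨m + 1, u, ?_⟩
    rw [hdrLogTraj, h1]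
    simp only [hdrLogStep, if_neg h2, h4, not_true_eq_false, if_false, dif_neg h]

theorem iterate_next {k : ℕ} (i : Fin k) (r : ℕ) :
    ((nextIdx^[r] i : Fin k) : ℕ) = ((i : ℕ) + r) % k := by
  induction r with
  | zero => simp [Nat.mod_eq_of_lt i.isLt]
  | succ r ih =>
    rw [Function.iterate_succ_apply']
    simp only [nextIdx, ih]
    rw [Nat.mod_add_mod, Nat.add_assoc]

/-- Theorem (HDR-Log-K-Bits): in a `k`-edge-connected graph with `k` pairwise
arc-disjoint arborescences rooted at `t`, the HDR-Log-K-Bits routing process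
(which stores only `current_id ∈ Fin k`, i.e. `⌈log₂ k⌉` rewritable header bits)
is `(k-1)`-resilient against dynamic failures: for every unstable-link set `F`
with `|F| ≤ k - 1`, every dynamic schedule `σ` on `F` whose trajectory satisfies
the non-trap assumption, every starting node `s` and starting arborescence `i₀`,
the packet reaches `t` after finitely many steps. -/
theorem hdr_log_k_bits_resilient
    (G : SimpleGraph V) (t : V) (k : ℕ) (hconn : EdgeConnected G k)
    (T : Fin k → Arb G t)
    (hdisj : ∀ i j : Fin k, i ≠ j → ArcDisjoint (T i) (T j))
    (F : Set (Sym2 V)) (hFE : F ⊆ G.edgeSet) (hF : F.ncard ≤ k - 1)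
    (σ : ℕ → Set (Sym2 V)) (hσ : ∀ n, σ n ⊆ F)
    (s : V) (i₀ : Fin k)
    (hnontrap : ∀ n, (G.deleteEdges F).Reachable (hdrLogTraj T σ s i₀ n).1
        (hdrLogTraj T σ s i₀ (n + 1)).1) :
    ∃ n, (hdrLogTraj T σ s i₀ n).1 = t := by
  by_contra hcon
  have hne : ∀ n, (hdrLogTraj T σ s i₀ n).1 ≠ t := fun n hn => hcon ⟨n, hn⟩
  have hk := i₀.pos
  obtain ⟨g, hg⟩ := exists_good G t k T hdisj F (by omega)
  have hall : ∀ r, ∃ n v, hdrLogTraj T σ s i₀ n = (v, nextIdx^[r] i₀, nextIdx^[r] i₀) := by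
    intro r
    induction r with
    | zero => exact ⟨0, s, rfl⟩
    | succ r ih =>
      rw [Function.iterate_succ_apply']
      exact phase T σ s i₀ hne _ ih
  have hgi : nextIdx^[k - (i₀ : ℕ) + g] i₀ = g := by
    apply Fin.ext
    rw [iterate_next]
    have : (i₀ : ℕ) + (k - (i₀ : ℕ) + g) = k + g := by have := i₀.isLt; omega
    rw [this, Nat.add_mod_left, Nat.mod_eq_of_lt g.isLt]
  obtain ⟨n, v, hv⟩ := hall (k - (i₀ : ℕ) + g)
  rw [hgi] at hv
  obtain ⟨m, u, h1, h2, -, h4⟩ := canonical T σ s i₀ hne g g _ n v le_rfl hv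
  obtain ⟨j, hj, hclean⟩ := hg u h2 (hσ m h4)
  have hjg : j ≠ g := by
    rintro rfl
    have a := (T j).depth_par u h2
    have b := (T j).depth_par _ hj.1
    rw [hj.2] at b
    omega
  have h : ∃ j : Fin k, j ≠ g ∧ (T j).Arc ((T g).par u) u := ⟨j, hjg, hj⟩
  have hs : hdrLogTraj T σ s i₀ (m + 1) = (u, h.choose, g) := by
    rw [hdrLogTraj, h1]
    simp only [hdrLogStep, if_neg h2, h4, not_true_eq_false, if_false, dif_pos h, ne_eq]
  have hch : h.choose = j := by
    by_contra hne'
    exact hdisj _ _ hne' _ _ ⟨h.choose_spec.2, hj⟩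
  rw [hch] at hs
  obtain ⟨m', u', h1', h2', h3', h4'⟩ := canonical T σ s i₀ hne j g _ _ u le_rfl hs
  have b := (T j).depth_par _ hj.1
  rw [hj.2] at b
  exact hclean u' h2' (by omega) (hσ m' h4')

end FRR
end

section
/- There exist a finite 4-edge-connected undirected graph G with vertex set {a,b,c,d,x,t} and edge set consisting of all six pairs among {a,b,c,d} together with the edges {a,t},{b,t},{c,t},{d,t},{a,x},{b,x},{c,x},{d,x}, four pairwise arc-disjoint arborescences of G rooted at t, and a dynamic failure schedule on the three unstable links F = {{a,b},{b,c},{c,d}} satisfying the non-trap assumption, such that the HDR-3-Bits routing process started at x never delivers the packet to t, although x and t are connected in G ∖ F. Consequently, for k ≥ 4 the HDR-3-Bits process need not be (k−1)-resilient against dynamic failures on k-edge-connected graphs. -/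
namespace FRR

open scoped Classical

variable {V : Type*} [Fintype V] [DecidableEq V]

/-- The state of the HDR-3-Bits process: current position, mode of operation
(`0` = canonical, `1` = bounced, `2` = retracing; maintained by the 3 rewritable
header bits), the current canonical arborescence index `i`, the bounce arborescence
index `j`, the node at which the current bounce started, and the distance travelled
along the bounce path. -/
structure Hdr3State (V : Type*) (k : ℕ) where
  pos : V
  mode : Fin 3
  i : Fin k
  j : Fin k
  origin : V
  dist : ℕ

/-- One step of the HDR-3-Bits process at time `n`.
Canonical mode: route along `T i`; upon a down outgoing arc `(u, w)`, if the reversed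
arc `(w, u)` lies on some `T j`, `j ≠ i`, bounce onto `T j` (entering bounced mode at
`u`); otherwise move on to the next arborescence.  Bounced mode: route canonically
along `T j`; upon a down outgoing arc, start retracing.  Retracing mode: walk the
traversed path of `T j` backwards until a down link of `T j` incident to the retraced
path is encountered — either a retraced path arc that is now down, whose reverse arc
determines a (possibly wrong, under dynamic failures) arborescence index `i'`, after
which the process sets `i := i' + 1 (mod k)` and resumes canonical mode, or, upon
returning to the bounce origin, the failure originally bounced on, after which the
process sets `i := i + 1 (mod k)` and resumes canonical mode. -/
noncomputable def hdr3Step {G : SimpleGraph V} {t : V} {k : ℕ}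
    (T : Fin k → Arb G t) (σ : ℕ → Set (Sym2 V)) (n : ℕ)
    (st : Hdr3State V k) : Hdr3State V k :=
  if st.pos = t then st
  else if st.mode = 0 then
    let w := (T st.i).par st.pos
    if s(st.pos, w) ∉ σ n then { st with pos := w }
    else if h : ∃ j : Fin k, j ≠ st.i ∧ (T j).Arc w st.pos then
      { st with mode := 1, j := h.choose, origin := st.pos, dist := 0 }
    else { st with i := nextIdx st.i }
  else if st.mode = 1 then
    let w := (T st.j).par st.pos
    if s(st.pos, w) ∉ σ n then { st with pos := w, dist := st.dist + 1 }
    else { st with mode := 2 }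
  else
    if st.dist = 0 then { st with mode := 0, i := nextIdx st.i }
    else
      let x' := ((T st.j).par)^[st.dist - 1] st.origin
      if s(x', st.pos) ∈ σ n then
        let i' := if h : ∃ i' : Fin k, (T i').Arc st.pos x' then h.choose else st.i
        { st with mode := 0, i := nextIdx i' }
      else { st with pos := x', dist := st.dist - 1 }

/-- The trajectory of the HDR-3-Bits process started at node `s` (in canonical mode
on the first arborescence), under the failure schedule `σ`. -/
noncomputable def hdr3Traj {G : SimpleGraph V} {t : V} {k : ℕ} (hk : 0 < k)
    (T : Fin k → Arb G t) (σ : ℕ → Set (Sym2 V)) (s : V) : ℕ → Hdr3State V k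
  | 0 => ⟨s, 0, ⟨0, hk⟩, ⟨0, hk⟩, s, 0⟩
  | n + 1 => hdr3Step T σ n (hdr3Traj hk T σ s n)

/-- The graph of Fig. 2: vertices `a = 0, b = 1, c = 2, d = 3, x = 4, t = 5`;
edges: all six pairs among `{a,b,c,d}`, plus `{v,t}` and `{v,x}` for every
`v ∈ {a,b,c,d}`. -/
def G8 : SimpleGraph (Fin 6) :=
  SimpleGraph.fromEdgeSet
    {s(0, 1), s(0, 2), s(0, 3), s(1, 2), s(1, 3), s(2, 3),
     s(0, 5), s(1, 5), s(2, 5), s(3, 5),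
     s(0, 4), s(1, 4), s(2, 4), s(3, 4)}

/-- The three unstable links `F = {{a,b}, {b,c}, {c,d}}`. -/
def F8 : Set (Sym2 (Fin 6)) := {s(0, 1), s(1, 2), s(2, 3)}

/-! ### Edge connectivity -/

/-- The fourteen edges of `G8` as ordered pairs. -/
def pairs8 : Finset (Fin 6 × Fin 6) :=
  {(0, 1), (0, 2), (0, 3), (1, 2), (1, 3), (2, 3),
   (0, 5), (1, 5), (2, 5), (3, 5), (0, 4), (1, 4), (2, 4), (3, 4)}

theorem pairs8_lt : ∀ p ∈ pairs8, p.1 < p.2 := by decide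

theorem G8_adj_of_mem : ∀ p ∈ pairs8, G8.Adj p.1 p.2 := by
  intro p hp
  simp only [pairs8, Finset.mem_insert, Finset.mem_singleton] at hp
  rcases hp with h | h | h | h | h | h | h | h | h | h | h | h | h | h <;> subst h <;>
    simp [G8]

set_option maxRecDepth 100000 in
set_option maxHeartbeats 4000000 in
theorem cut8 : ∀ S : Finset (Fin 6), 0 ∈ S → S ≠ Finset.univ →
    4 ≤ (pairs8.filter (fun p => (p.1 ∈ S) ≠ (p.2 ∈ S))).card := by
  have key : ∀ f : Fin 6 → Bool, f 0 = true → (∃ v, f v = false) →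
      4 ≤ (pairs8.filter (fun p => f p.1 ≠ f p.2)).card := by decide
  intro S h0 hS
  have h := key (fun v => decide (v ∈ S)) (by simpa using h0) (by
    by_contra hcon
    push Not at hcon
    apply hS
    ext v
    simpa using hcon v)
  convert h using 3
  simp

theorem edgeConnected8 : EdgeConnected G8 4 := by
  intro F _ hF
  have hfin : F.Finite := Set.toFinite F
  have main : ∀ v, (G8.deleteEdges F).Reachable 0 v := by
    by_contra hcon
    push Not at hcon
    obtain ⟨v, hv⟩ := hcon
    let S : Finset (Fin 6) := Finset.univ.filter (fun w => (G8.deleteEdges F).Reachable 0 w)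
    have hS : ∀ w, w ∈ S ↔ (G8.deleteEdges F).Reachable 0 w := by
      intro w; simp [S]
    have h4 := cut8 S ((hS 0).2 (SimpleGraph.Reachable.refl 0)) (by
      intro h
      exact hv ((hS v).1 (h ▸ Finset.mem_univ v)))
    set P := pairs8.filter (fun p => (p.1 ∈ S) ≠ (p.2 ∈ S)) with hP
    have hinj : Set.InjOn (fun p : Fin 6 × Fin 6 => s(p.1, p.2)) (P : Set (Fin 6 × Fin 6)) := by
      rintro ⟨a, b⟩ hp ⟨c, d⟩ hq h
      have h1 := pairs8_lt _ (Finset.mem_filter.1 hp).1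
      have h2 := pairs8_lt _ (Finset.mem_filter.1 hq).1
      simp only [Sym2.eq_iff] at h
      rcases h with ⟨h, h'⟩ | ⟨h, h'⟩
      · rw [h, h']
      · subst h h'
        exact absurd h1 (not_lt.2 h2.le)
    have hsub : (P.image (fun p : Fin 6 × Fin 6 => s(p.1, p.2)) : Set (Sym2 (Fin 6))) ⊆ F := by
      intro e he
      obtain ⟨p, hp, rfl⟩ := Finset.mem_image.1 (Finset.mem_coe.1 he)
      by_contra hne
      obtain ⟨hp1, hp2⟩ := Finset.mem_filter.1 hp
      have hadj : (G8.deleteEdges F).Adj p.1 p.2 := by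
        rw [SimpleGraph.deleteEdges_adj]
        exact ⟨G8_adj_of_mem p hp1, hne⟩
      apply hp2
      rw [hS, hS]
      exact propext ⟨fun h => h.trans hadj.reachable, fun h => h.trans hadj.symm.reachable⟩
    have hle := Set.ncard_le_ncard hsub hfin
    rw [Set.ncard_coe_finset, Finset.card_image_of_injOn hinj] at hle
    omega
  have : Nonempty (Fin 6) := ⟨0⟩
  exact ⟨fun u v => (main u).symm.trans (main v)⟩

/-! ### The arborescences -/

/-- Parent maps of the four arborescences. -/
def par8 : Fin 4 → Fin 6 → Fin 6 :=
  ![![2, 4, 3, 5, 2, 5], ![5, 0, 1, 2, 3, 5], ![4, 5, 4, 4, 1, 5], ![3, 2, 5, 1, 0, 5]]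

theorem par8_pairs : ∀ i v, v ≠ 5 → (v, par8 i v) ∈ pairs8 ∨ (par8 i v, v) ∈ pairs8 := by
  decide

theorem par8_reaches : ∀ i v, (par8 i)^[5] v = 5 := by decide

theorem par8_disj : ∀ i j v, i ≠ j → v ≠ 5 → par8 i v ≠ par8 j v := by decide

/-- The four arborescences. -/
def T8 (i : Fin 4) : Arb G8 (5 : Fin 6) where
  par := par8 i
  adj v hv := by
    rcases par8_pairs i v hv with h | h
    · exact G8_adj_of_mem _ h
    · exact (G8_adj_of_mem _ h).symm
  reaches v := ⟨5, par8_reaches i v⟩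

/-! ### The periodic run -/

/-- The states of the run. -/
def st8 : Fin 8 → Hdr3State (Fin 6) 4 :=
  ![⟨4, 0, 0, 0, 4, 0⟩, ⟨2, 0, 0, 0, 4, 0⟩, ⟨2, 1, 0, 1, 2, 0⟩, ⟨1, 1, 0, 1, 2, 1⟩,
    ⟨1, 2, 0, 1, 2, 1⟩, ⟨1, 0, 0, 1, 2, 1⟩, ⟨4, 0, 0, 1, 2, 1⟩, ⟨2, 0, 0, 1, 2, 1⟩]

/-- The links that are down in each state of the run. -/
def dn8 : Fin 8 → Set (Sym2 (Fin 6)) :=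
  ![∅, {s(2, 3)}, ∅, {s(0, 1)}, {s(1, 2)}, ∅, ∅, {s(2, 3)}]

/-- The successor index in the run. -/
def nx8 : Fin 8 → Fin 8 := ![1, 2, 3, 4, 5, 6, 7, 2]

theorem bounce_choose (h : ∃ j : Fin 4, j ≠ 0 ∧ (T8 j).Arc 3 2) : h.choose = 1 := by
  have key : ∀ j : Fin 4, par8 j 3 = 2 → j = 1 := by decide
  exact key _ h.choose_spec.2.2

theorem retrace_choose (h : ∃ j : Fin 4, (T8 j).Arc 1 2) : h.choose = 3 := by
  have key : ∀ j : Fin 4, par8 j 1 = 2 → j = 3 := by decide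
  exact key _ h.choose_spec.2

theorem bounce_step (σ : ℕ → Set (Sym2 (Fin 6))) (n : ℕ) (h : s(2, 3) ∈ σ n)
    (j : Fin 4) (o : Fin 6) (d : ℕ) :
    hdr3Step T8 σ n ⟨2, 0, 0, j, o, d⟩ = ⟨2, 1, 0, 1, 2, 0⟩ := by
  have hw : (T8 0).par 2 = 3 := by decide
  have hex : ∃ j : Fin 4, j ≠ 0 ∧ (T8 j).Arc 3 2 := ⟨1, by decide, by decide, by decide⟩
  have h25 : (2 : Fin 6) ≠ 5 := by decide
  unfold hdr3Step
  simp only [h25, hw, h, not_true_eq_false, if_false, if_true, dif_pos hex, bounce_choose hex]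

theorem retrace_step (σ : ℕ → Set (Sym2 (Fin 6))) (n : ℕ) (h : s(2, 1) ∈ σ n) :
    hdr3Step T8 σ n ⟨1, 2, 0, 1, 2, 1⟩ = ⟨1, 0, 0, 1, 2, 1⟩ := by
  have hex : ∃ j : Fin 4, (T8 j).Arc 1 2 := ⟨3, by decide, by decide⟩
  have h15 : (1 : Fin 6) ≠ 5 := by decide
  have h20 : (2 : Fin 3) ≠ 0 := by decide
  have h21 : (2 : Fin 3) ≠ 1 := by decide
  have hnx : nextIdx (3 : Fin 4) = 0 := by decide
  unfold hdr3Step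
  simp only [h15, h20, h21, if_false, one_ne_zero, Nat.sub_self, Function.iterate_zero, id, h,
    if_true, dif_pos hex, retrace_choose hex, hnx]

theorem canon_step (σ : ℕ → Set (Sym2 (Fin 6))) (n : ℕ) (h : σ n = ∅)
    (p : Fin 6) (hp : p ≠ 5) (i j : Fin 4) (o : Fin 6) (d : ℕ) :
    hdr3Step T8 σ n ⟨p, 0, i, j, o, d⟩ = ⟨par8 i p, 0, i, j, o, d⟩ := by
  unfold hdr3Step
  simp [hp, h, T8]

theorem run_step (σ : ℕ → Set (Sym2 (Fin 6))) (n : ℕ) (k : Fin 8) (h : σ n = dn8 k) :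
    hdr3Step T8 σ n (st8 k) = st8 (nx8 k) := by
  have h15 : (1 : Fin 6) ≠ 5 := by decide
  have h25 : (2 : Fin 6) ≠ 5 := by decide
  have h10 : (1 : Fin 3) ≠ 0 := by decide
  fin_cases k
  · exact canon_step σ n h 4 (by decide) 0 0 4 0
  · exact bounce_step σ n (by rw [h]; exact rfl) 0 4 0
  · have h' : σ n = ∅ := h
    change hdr3Step T8 σ n ⟨2, 1, 0, 1, 2, 0⟩ = ⟨par8 1 2, 1, 0, 1, 2, 0 + 1⟩
    unfold hdr3Step
    simp [h25, h', T8]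
  · have hw : (T8 1).par 1 = 0 := by decide
    have h' : s(1, 0) ∈ σ n := by rw [h, Sym2.eq_swap]; exact rfl
    change hdr3Step T8 σ n ⟨1, 1, 0, 1, 2, 1⟩ = ⟨1, 2, 0, 1, 2, 1⟩
    unfold hdr3Step
    simp only [h15, h10, hw, h', not_true_eq_false, if_false, if_true]
  · exact retrace_step σ n (by rw [h, Sym2.eq_swap]; exact rfl)
  · exact canon_step σ n h 1 (by decide) 0 1 2 1
  · exact canon_step σ n h 4 (by decide) 0 1 2 1
  · exact bounce_step σ n (by rw [h]; exact rfl) 1 2 1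

/-- The failure schedule. -/
def sched8 (n : ℕ) : Set (Sym2 (Fin 6)) := dn8 (nx8^[n] 0)

theorem traj8 (hk : 0 < 4) (n : ℕ) : hdr3Traj hk T8 sched8 4 n = st8 (nx8^[n] 0) := by
  induction n with
  | zero => rfl
  | succ n ih =>
    rw [Function.iterate_succ_apply', ← run_step sched8 n _ rfl, ← ih]
    rfl

theorem st8_pos : ∀ k, (st8 k).pos ≠ 5 := by decide

theorem dn8_sub (k : Fin 8) : dn8 k ⊆ F8 := by
  fin_cases k <;> simp [dn8, F8]

theorem connected8 : (G8.deleteEdges F8).Connected := by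
  apply edgeConnected8
  · intro e he
    simp only [F8, Set.mem_insert_iff, Set.mem_singleton_iff] at he
    rcases he with rfl | rfl | rfl <;> simp [G8]
  · have h1 := Set.ncard_insert_le (s(0, 1) : Sym2 (Fin 6)) {s(1, 2), s(2, 3)}
    have h2 := Set.ncard_insert_le (s(1, 2) : Sym2 (Fin 6)) {s(2, 3)}
    rw [Set.ncard_singleton] at h2
    unfold F8
    omega

/-- Theorem (counter-example to HDR-3-Bits under dynamic failures): `G8` is
4-edge-connected, and there exist four pairwise arc-disjoint arborescences of `G8`
rooted at `t = 5` and a dynamic failure schedule on the three unstable links `F8`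
satisfying the non-trap assumption, such that the HDR-3-Bits process started at
`x = 4` never delivers the packet to `t`, although `x` and `t` are connected
in `G8 ∖ F8`. -/
theorem hdr_three_bits_dynamic_counterexample :
    EdgeConnected G8 4 ∧
    ∃ T : Fin 4 → Arb G8 (5 : Fin 6),
      (∀ i j : Fin 4, i ≠ j → ArcDisjoint (T i) (T j)) ∧
      ∃ σ : ℕ → Set (Sym2 (Fin 6)),
        (∀ n, σ n ⊆ F8) ∧
        (∀ n, (G8.deleteEdges F8).Reachable
            (hdr3Traj (by norm_num) T σ (4 : Fin 6) n).pos
            (hdr3Traj (by norm_num) T σ (4 : Fin 6) (n + 1)).pos) ∧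
        (G8.deleteEdges F8).Reachable (4 : Fin 6) (5 : Fin 6) ∧
        ∀ n, (hdr3Traj (by norm_num) T σ (4 : Fin 6) n).pos ≠ (5 : Fin 6) := by
  refine ⟨edgeConnected8, T8, ?_, sched8, fun n => dn8_sub _, ?_, ?_, ?_⟩
  · rintro i j hij u v ⟨⟨hu, h1⟩, ⟨_, h2⟩⟩
    exact par8_disj i j u hij hu (h1.trans h2.symm)
  · intro n
    exact connected8.preconnected _ _
  · exact connected8.preconnected _ _
  · intro n
    rw [traj8]
    exact st8_pos _

end FRR
end

section
/- For every finite connected undirected graph G = (V,E) and every destination t ∈ V, there exists a routing scheme for t that is 1-resilient against dynamic failures: for every single unstable link e ∈ E, every dynamic schedule on {e} satisfying the non-trap assumption, and every source s in the same connected component as t in G ∖ {e}, the packet trajectory reaches t after finitely many steps. -/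
namespace FRR

open scoped Classical

variable {V : Type*} [Fintype V] [DecidableEq V]

/-- `a` is an ancestor of `x` with respect to the parent map `p`. -/
def Anc {W : Type*} (p : W → W) (a x : W) : Prop := ∃ k : ℕ, p^[k] x = a

lemma Anc.rfl' {W : Type*} (p : W → W) (a : W) : Anc p a a := ⟨0, rfl⟩

lemma Anc.trans' {W : Type*} {p : W → W} {a b c : W} (h1 : Anc p a b) (h2 : Anc p b c) :
    Anc p a c := by
  obtain ⟨k, rfl⟩ := h1
  obtain ⟨l, rfl⟩ := h2
  exact ⟨k + l, by rw [Function.iterate_add_apply]⟩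

lemma Anc.of_parent {W : Type*} {p : W → W} {a x : W} (h : Anc p a (p x)) : Anc p a x :=
  h.trans' ⟨1, rfl⟩

lemma Anc.eq_or {W : Type*} {p : W → W} {a x : W} (h : Anc p a x) : x = a ∨ Anc p a (p x) := by
  obtain ⟨k, hk⟩ := h
  cases k with
  | zero => exact Or.inl hk
  | succ k => exact Or.inr ⟨k, by simpa [Function.iterate_succ_apply] using hk⟩

lemma Anc.comparable {W : Type*} {p : W → W} {a b x : W} (h1 : Anc p a x) (h2 : Anc p b x) :
    Anc p a b ∨ Anc p b a := by
  obtain ⟨k, rfl⟩ := h1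
  obtain ⟨l, rfl⟩ := h2
  rcases le_total k l with h | h
  · right
    exact ⟨l - k, by rw [← Function.iterate_add_apply, Nat.sub_add_cancel h]⟩
  · left
    exact ⟨k - l, by rw [← Function.iterate_add_apply, Nat.sub_add_cancel h]⟩

lemma Anc.child {W : Type*} {p : W → W} {t : W} (pt : p t = t) {w x : W} (h : Anc p w x) :
    x = w ∨ ∃ c, c ≠ t ∧ p c = w ∧ Anc p c x := by
  obtain ⟨k, hk⟩ := h
  induction k generalizing x with
  | zero => exact Or.inl hk
  | succ k ih =>
    rw [Function.iterate_succ_apply] at hk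
    rcases ih hk with h | ⟨c, hc, hpc, hcx⟩
    · by_cases hx : x = t
      · left
        rw [← h, hx, pt]
      · exact Or.inr ⟨x, hx, h, Anc.rfl' p x⟩
    · exact Or.inr ⟨c, hc, hpc, hcx.of_parent⟩

lemma Anc.le {W : Type*} {p : W → W} {t : W} {d : W → ℕ} (pt : p t = t)
    (hd : ∀ x, x ≠ t → d (p x) < d x) {a x : W} (h : Anc p a x) : d a ≤ d x := by
  obtain ⟨k, hk⟩ := h
  induction k generalizing x with
  | zero => exact le_of_eq (congrArg d hk.symm)
  | succ k ih =>
    rw [Function.iterate_succ_apply] at hk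
    have := ih hk
    by_cases hx : x = t
    · subst hx
      rwa [pt] at this
    · exact this.trans (hd x hx).le

/-- Number of common ancestors. -/
noncomputable def comm {W : Type*} (p : W → W) (x y : W) : ℕ :=
  {a | Anc p a x ∧ Anc p a y}.ncard

lemma comm_lt {W : Type*} [Finite W] {p : W → W} {v x y : W} (h1 : Anc p v x)
    (h2 : ¬ Anc p v y) : comm p x y < comm p v v := by
  apply Set.ncard_lt_ncard _ (Set.toFinite _)
  rw [Set.ssubset_iff_of_subset]
  · exact ⟨v, ⟨Anc.rfl' p v, Anc.rfl' p v⟩, fun h => h2 h.2⟩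
  · rintro a ⟨hx, hy⟩
    rcases hx.comparable h1 with h | h
    · exact ⟨h, h⟩
    · exact absurd (h.trans' hy) h2

lemma le_comm {W : Type*} [Finite W] {p : W → W} {v x y : W} (h1 : Anc p v x)
    (h2 : Anc p v y) : comm p v v ≤ comm p x y := by
  apply Set.ncard_le_ncard _ (Set.toFinite _)
  rintro a ⟨ha, -⟩
  exact ⟨ha.trans' h1, ha.trans' h2⟩

/-- The values of non-parent arcs leaving a node of the subtree of `w`. -/
def Arcs {W : Type*} (G : SimpleGraph W) (p : W → W) (w : W) : Set ℕ :=
  {m | ∃ x y, Anc p w x ∧ G.Adj x y ∧ y ≠ p x ∧ comm p x y = m}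

/-- `n` is a correct next hop of `w` in recovery mode. -/
def GoodNext {W : Type*} (G : SimpleGraph W) (p : W → W) (t w n : W) (m : ℕ) : Prop :=
  G.Adj w n ∧ ((n ≠ p w ∧ comm p w n = m) ∨ (p n = w ∧ n ≠ t ∧ IsLeast (Arcs G p n) m))

lemma exists_goodNext {W : Type*} {G : SimpleGraph W} {p : W → W} {t : W} (pt : p t = t)
    (hadj : ∀ x, x ≠ t → G.Adj x (p x)) {w : W} {m : ℕ} (h : IsLeast (Arcs G p w) m) :
    ∃ n, GoodNext G p t w n m := by
  obtain ⟨⟨x, y, hwx, hxy, hy, hm⟩, hmin⟩ := h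
  rcases hwx.child pt with h | ⟨c, hct, hpc, hcx⟩
  · subst h
    exact ⟨y, hxy, Or.inl ⟨hy, hm⟩⟩
  · refine ⟨c, ?_, Or.inr ⟨hpc, hct, ⟨x, y, hcx, hxy, hy, hm⟩, ?_⟩⟩
    · rw [← hpc]
      exact (hadj c hct).symm
    · rintro k ⟨x', y', h1, h2, h3, h4⟩
      exact hmin ⟨x', y', Anc.trans' ⟨1, hpc⟩ h1, h2, h3, h4⟩

/-- The forwarding scheme: go to the parent, unless the packet came from the parent or the
parent link is down, in which case use the recovery next hop. -/
noncomputable def scheme (G : SimpleGraph V) (p nxt : V → V) : FwdScheme G where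
  fwd v ip A :=
    if ip ≠ some (p v) ∧ p v ∈ A then p v
    else if nxt v ∈ A then nxt v
    else if h : A.Nonempty then h.choose else v
  mem v ip A hA := by
    split_ifs with h1 h2
    · exact h1.2
    · exact h2
    · exact hA.choose_spec

lemma traj_step_s10 {G : SimpleGraph V} (P : FwdScheme G) {σ : ℕ → Set (Sym2 V)} {t s w u : V}
    {ip : Option V} {n : ℕ} (h : P.traj σ t s n = (w, ip)) (hw : w ≠ t)
    (hu : G.Adj w u) (hs : s(w, u) ∉ σ n)
    (hf : P.fwd w ip {u : V | G.Adj w u ∧ s(w, u) ∉ σ n} = u) :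
    P.traj σ t s (n + 1) = (u, some w) := by
  have hne : ({u : V | G.Adj w u ∧ s(w, u) ∉ σ n} : Set V).Nonempty := ⟨u, hu, hs⟩
  simp only [FwdScheme.traj, h]
  rw [if_neg hw, if_pos hne, hf]

lemma normal_step {G : SimpleGraph V} {p nxt : V → V} {σ : ℕ → Set (Sym2 V)} {t s w : V}
    {ip : Option V} {n : ℕ} (h : (scheme G p nxt).traj σ t s n = (w, ip)) (hw : w ≠ t)
    (hip : ip ≠ some (p w)) (hadj : G.Adj w (p w)) (hs : s(w, p w) ∉ σ n) :
    (scheme G p nxt).traj σ t s (n + 1) = (p w, some w) := by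
  refine traj_step_s10 _ h hw hadj hs ?_
  exact if_pos ⟨hip, hadj, hs⟩

lemma recovery_step {G : SimpleGraph V} {p nxt : V → V} {σ : ℕ → Set (Sym2 V)} {t s w : V}
    {ip : Option V} {n : ℕ} (h : (scheme G p nxt).traj σ t s n = (w, ip)) (hw : w ≠ t)
    (hip : ip = some (p w) ∨ s(w, p w) ∈ σ n) (hadj : G.Adj w (nxt w))
    (hs : s(w, nxt w) ∉ σ n) :
    (scheme G p nxt).traj σ t s (n + 1) = (nxt w, some w) := by
  refine traj_step_s10 _ h hw hadj hs ?_
  have h1 : ¬ (ip ≠ some (p w) ∧ p w ∈ {u : V | G.Adj w u ∧ s(w, u) ∉ σ n}) := by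
    rintro ⟨h1, -, h2⟩
    exact hip.elim h1 h2
  have h2 : nxt w ∈ {u : V | G.Adj w u ∧ s(w, u) ∉ σ n} := ⟨hadj, hs⟩
  exact (if_neg h1).trans (if_pos h2)

/-- Normal mode: the packet reaches `t` or is stopped by a failed parent link. -/
lemma normal_mode {G : SimpleGraph V} {p nxt : V → V} {σ : ℕ → Set (Sym2 V)} {t s : V}
    {d : V → ℕ} (pt : p t = t) (hd : ∀ x, x ≠ t → d (p x) < d x)
    (hadj : ∀ x, x ≠ t → G.Adj x (p x)) (Q : V → Prop) (hQ : ∀ x, Q x → Q (p x)) :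
    ∀ (N n : ℕ) (w : V) (ip : Option V), d w ≤ N → Q w →
      (scheme G p nxt).traj σ t s n = (w, ip) → ip ≠ some (p w) →
      (∃ m, ((scheme G p nxt).traj σ t s m).1 = t) ∨
      ∃ m v ip', (scheme G p nxt).traj σ t s m = (v, ip') ∧ v ≠ t ∧ Q v ∧ s(v, p v) ∈ σ m := by
  intro N
  induction N with
  | zero =>
    intro n w ip hN hq h hip
    left
    refine ⟨n, ?_⟩
    rw [h]
    by_contra hw
    have := hd w hw
    omega
  | succ N ih =>
    intro n w ip hN hq h hip
    by_cases hw : w = t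
    · exact Or.inl ⟨n, by rw [h]; exact hw⟩
    by_cases hs : s(w, p w) ∈ σ n
    · exact Or.inr ⟨n, w, ip, h, hw, hq, hs⟩
    have h1 := normal_step h hw hip (hadj w hw) hs
    have h2 := hd w hw
    refine ih (n + 1) (p w) (some w) (by omega) (hQ w hq) h1 ?_
    intro h3
    have h4 : w = p (p w) := Option.some.inj h3
    by_cases h5 : p w = t
    · rw [h5, pt] at h4
      exact hw h4
    · have := hd _ h5
      rw [← h4] at this
      omega

/-- Recovery mode: after a failure of the parent link of `v` the packet reaches `t`. -/
lemma recovery_mode {G : SimpleGraph V} {p nxt : V → V} {σ : ℕ → Set (Sym2 V)} {t s v : V}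
    {d : V → ℕ} (pt : p t = t) (hd : ∀ x, x ≠ t → d (p x) < d x)
    (hadj : ∀ x, x ≠ t → G.Adj x (p x))
    (hnxt : ∀ w m, IsLeast (Arcs G p w) m → GoodNext G p t w (nxt w) m)
    (hv : v ≠ t) (hσ : ∀ n, σ n ⊆ {s(v, p v)}) (B : ℕ) (hB : ∀ x, d x ≤ B) :
    ∀ (N n : ℕ) (w : V) (ip : Option V) (m : ℕ), B - d w = N → Anc p v w →
      IsLeast (Arcs G p w) m → m < comm p v v →
      (scheme G p nxt).traj σ t s n = (w, ip) → (ip = some (p w) ∨ s(w, p w) ∈ σ n) →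
      ∃ m, ((scheme G p nxt).traj σ t s m).1 = t := by
  have hpv : ¬ Anc p v (p v) := fun h => by
    have := h.le pt hd
    have := hd v hv
    omega
  intro N
  induction N using Nat.strong_induction_on with
  | _ N ih =>
    intro n w ip m hN hvw hm hmv h hip
    by_cases hw : w = t
    · exact ⟨n, by rw [h]; exact hw⟩
    obtain ⟨ha, h1 | ⟨h1, h2, h3⟩⟩ := hnxt w m hm
    · have hout : ¬ Anc p v (nxt w) := fun hc => by
        have := le_comm hvw hc
        omega
      have hs : s(w, nxt w) ∉ σ n := by
        intro hc
        have hc' : s(w, nxt w) = s(v, p v) := hσ n hc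
        rcases Sym2.eq_iff.1 hc' with ⟨e1, e2⟩ | ⟨e1, e2⟩
        · exact h1.1 (by rw [e2, e1])
        · exact hpv (e1 ▸ hvw)
      have hstep := recovery_step h hw hip ha hs
      have hnm := normal_mode (G := G) (nxt := nxt) (σ := σ) (s := s) pt hd hadj
        (fun x => ¬ Anc p v x) (fun x hx hc => hx hc.of_parent) (d (nxt w)) (n + 1) (nxt w)
        (some w) le_rfl hout hstep
        (fun hc => hout (Anc.of_parent (by rw [← Option.some.inj hc]; exact hvw)))
      rcases hnm with hnm | ⟨m', v', ip', -, hv't, hv', hf⟩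
      · exact hnm
      · exfalso
        have hc' : s(v', p v') = s(v, p v) := hσ m' hf
        rcases Sym2.eq_iff.1 hc' with ⟨e1, e2⟩ | ⟨e1, e2⟩
        · exact hv' (e1 ▸ Anc.rfl' p v)
        · exact hv' (Anc.of_parent (e2 ▸ Anc.rfl' p v))
    · have hvn : Anc p v (nxt w) := Anc.of_parent (by rw [h1]; exact hvw)
      have hs : s(w, nxt w) ∉ σ n := by
        intro hc
        have hc' : s(w, nxt w) = s(v, p v) := hσ n hc
        rcases Sym2.eq_iff.1 hc' with ⟨e1, e2⟩ | ⟨e1, e2⟩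
        · exact hpv (e2 ▸ hvn)
        · exact hpv (e1 ▸ hvw)
      have hstep := recovery_step h hw hip ha hs
      have hlt := hd _ h2
      rw [h1] at hlt
      have hle := hB (nxt w)
      exact ih (B - d (nxt w)) (by omega) (n + 1) (nxt w) (some w) m rfl hvn h3 hmv hstep
        (Or.inl (by rw [h1]))

/-- Existence of a parent map towards `t`. -/
lemma exists_parent (G : SimpleGraph V) (t : V) (hconn : G.Connected) :
    ∃ p : V → V, p t = t ∧ (∀ x, x ≠ t → G.dist (p x) t < G.dist x t) ∧
      ∀ x, x ≠ t → G.Adj x (p x) := by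
  have key : ∀ x, ∃ y, (x = t → y = t) ∧ (x ≠ t → G.dist y t < G.dist x t ∧ G.Adj x y) := by
    intro x
    by_cases hx : x = t
    · exact ⟨t, fun _ => rfl, fun h => absurd hx h⟩
    · obtain ⟨q, hq⟩ := hconn.exists_walk_length_eq_dist x t
      cases q with
      | nil => exact absurd rfl hx
      | @cons _ y _ h q =>
        refine ⟨y, fun h => absurd h hx, fun _ => ⟨?_, h⟩⟩
        rw [← hq, SimpleGraph.Walk.length_cons]
        exact Nat.lt_succ_of_le (SimpleGraph.dist_le q)
  choose p hp using key
  exact ⟨p, (hp t).1 rfl, fun x hx => ((hp x).2 hx).1, fun x hx => ((hp x).2 hx).2⟩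

/-- A walk leaving a set uses an edge leaving the set. -/
lemma exists_leaving {W : Type*} {H : SimpleGraph W} {Q : W → Prop} {a b : W}
    (q : H.Walk a b) (ha : Q a) (hb : ¬ Q b) : ∃ x y, H.Adj x y ∧ Q x ∧ ¬ Q y := by
  induction q with
  | nil => exact absurd ha hb
  | @cons u c w h q ih =>
    by_cases hc : Q c
    · exact ih hc hb
    · exact ⟨u, c, h, ha, hc⟩

/-- Theorem (1-resilience on general graphs): every finite connected graph `G` with
destination `t` admits a routing scheme that is 1-resilient against dynamic failures:
for every single unstable link, every dynamic schedule on it whose trajectory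
satisfies the non-trap assumption, and every source connected to `t` in the graph
with the unstable link removed, the packet reaches `t` in finitely many steps. -/
theorem one_resilient_always
    (G : SimpleGraph V) (t : V) (hconn : G.Connected) :
    ∃ P : FwdScheme G, DynResilient P t 1 := by
  obtain ⟨p, pt, hd, hadj⟩ := exists_parent G t hconn
  have hn : ∀ w, ∃ n, ∀ m, IsLeast (Arcs G p w) m → GoodNext G p t w n m := by
    intro w
    by_cases h : ∃ m, IsLeast (Arcs G p w) m
    · obtain ⟨m, hm⟩ := h
      obtain ⟨n, hn⟩ := exists_goodNext pt hadj hm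
      exact ⟨n, fun m' hm' => hm.unique hm' ▸ hn⟩
    · exact ⟨w, fun m hm => absurd ⟨m, hm⟩ h⟩
  choose nxt hnxt using hn
  refine ⟨scheme G p nxt, ?_⟩
  intro F hF hcard σ hσ s htrap hst
  have hreach : ∀ n, (G.deleteEdges F).Reachable ((scheme G p nxt).traj σ t s n).1 t := by
    intro n
    induction n with
    | zero => exact hst
    | succ n ih => exact (htrap n).symm.trans ih
  have hnm := normal_mode (G := G) (nxt := nxt) (σ := σ) (s := s) (d := fun x => G.dist x t)
    pt hd hadj (fun _ => True) (fun _ h => h) _ 0 s none le_rfl trivial rfl (by simp)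
  rcases hnm with hnm | ⟨k, v, ip, hk, hv, -, hf⟩
  · exact hnm
  have hFeq : F ⊆ {s(v, p v)} := fun e he =>
    (Set.ncard_le_one (Set.toFinite F)).1 hcard e he _ (hσ k hf)
  have hvF : s(v, p v) ∈ F := hσ k hf
  have hvt := hreach k
  rw [hk] at hvt
  obtain ⟨q⟩ := hvt
  have hnt : ¬ Anc p v t := by
    rintro ⟨j, hj⟩
    rw [Function.iterate_fixed pt] at hj
    exact hv hj.symm
  obtain ⟨x, y, hxy, hvx, hvy⟩ := exists_leaving (Q := fun x => Anc p v x) q (Anc.rfl' p v) hnt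
  rw [SimpleGraph.deleteEdges_adj] at hxy
  have hne : comm p x y ∈ Arcs G p v := by
    refine ⟨x, y, hvx, hxy.1, ?_, rfl⟩
    intro hy
    rcases hvx.eq_or with h | h
    · exact hxy.2 (by rw [hy, h]; exact hvF)
    · exact hvy (hy ▸ h)
  have hleast : IsLeast (Arcs G p v) (sInf (Arcs G p v)) :=
    ⟨Nat.sInf_mem ⟨_, hne⟩, fun m hm => Nat.sInf_le hm⟩
  have hlt : sInf (Arcs G p v) < comm p v v :=
    lt_of_le_of_lt (Nat.sInf_le hne) (comm_lt hvx hvy)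
  obtain ⟨B, hB⟩ := (Set.finite_range (fun x => G.dist x t)).bddAbove
  exact recovery_mode (d := fun x => G.dist x t) pt hd hadj hnxt hv
    (fun n => (hσ n).trans hFeq) B (fun x => hB ⟨x, rfl⟩) _ k v ip _ rfl (Anc.rfl' p v) hleast
    hlt hk (Or.inr hf)

end FRR
end

section
/- Let G be the 2-edge-connected planar graph with vertex set {s, t, v_0, v_1, v_2, v_3, v_4, v_5, u_0, u_1, u_2, u_3, u_4, u_5} and edge set {{s,v_0},{v_0,v_1},{v_1,v_2},{v_2,v_3},{v_3,v_4},{v_4,v_1},{v_3,v_5},{v_5,t},{s,u_0},{u_0,u_1},{u_1,u_2},{u_2,u_3},{u_3,u_4},{u_4,u_1},{u_3,u_5},{u_5,t}}. Then no source-matched forwarding scheme for (s,t) on G (without rewriting bits in packet headers) is 2-resilient against dynamic failures. -/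
namespace FRR

open scoped Classical

variable {V : Type*} [Fintype V] [DecidableEq V]

/-- A source-matched forwarding scheme `P` for the pair `(s, t)` is `r`-resilient
against dynamic failures: for every `F ⊆ E` with `|F| ≤ r` such that `s` and `t` are
connected in `G ∖ F`, and every dynamic (arbitrary) schedule `σ` on `F` whose
trajectory satisfies the non-trap assumption, the packet originated at `s` reaches
`t` after finitely many steps. -/
def SrcDynResilient {G : SimpleGraph V} (P : FwdScheme G) (s t : V) (r : ℕ) : Prop :=
  ∀ F : Set (Sym2 V), F ⊆ G.edgeSet → F.ncard ≤ r →
    (G.deleteEdges F).Reachable s t →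
    ∀ σ : ℕ → Set (Sym2 V), (∀ n, σ n ⊆ F) →
      (∀ n, (G.deleteEdges F).Reachable (P.traj σ t s n).1 (P.traj σ t s (n + 1)).1) →
      ∃ n, (P.traj σ t s n).1 = t

/-- The graph of Fig. 4: vertices `s = 0, t = 1, v_i = 2 + i, u_i = 8 + i`
(for `0 ≤ i ≤ 5`), with edges `{s,v₀},{v₀,v₁},{v₁,v₂},{v₂,v₃},{v₃,v₄},{v₄,v₁},
{v₃,v₅},{v₅,t}` and the symmetric copies `{s,u₀},…,{u₅,t}`. -/
def G12 : SimpleGraph (Fin 14) :=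
  SimpleGraph.fromEdgeSet
    {s(0, 2), s(2, 3), s(3, 4), s(4, 5), s(5, 6), s(6, 3), s(5, 7), s(7, 1),
     s(0, 8), s(8, 9), s(9, 10), s(10, 11), s(11, 12), s(12, 9), s(11, 13), s(13, 1)}

/-- Neighbours of `v` along links outside `f`. -/
def Act (f : Set (Sym2 (Fin 14))) (v : Fin 14) : Set (Fin 14) :=
  {u | G12.Adj v u ∧ s(v, u) ∉ f}

theorem mem_act (f : Set (Sym2 (Fin 14))) (v u : Fin 14) :
    u ∈ Act f v ↔ G12.Adj v u ∧ s(v, u) ∉ f := Iff.rfl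

/-- One move from `p` that stays in `S`, using only failures in `F`. -/
def Stay (P : FwdScheme G12) (F : Set (Sym2 (Fin 14)))
    (S : Set (Fin 14 × Option (Fin 14))) (p : Fin 14 × Option (Fin 14)) : Prop :=
  p.1 ≠ 1 ∧ ∃ f, f ⊆ F ∧ (Act f p.1).Nonempty ∧ (P.fwd p.1 p.2 (Act f p.1), some p.1) ∈ S

theorem Stay.mk' {P : FwdScheme G12} {F : Set (Sym2 (Fin 14))}
    {S : Set (Fin 14 × Option (Fin 14))} {v : Fin 14} {ip : Option (Fin 14)}
    (f : Set (Sym2 (Fin 14))) (A : Set (Fin 14)) (hv : v ≠ 1) (hf : f ⊆ F) (hA : Act f v = A)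
    (hne : A.Nonempty) (h : ∀ w, w ∈ A → P.fwd v ip A = w → (w, some v) ∈ S) :
    Stay P F S (v, ip) := by
  subst hA
  exact ⟨hv, f, hf, hne, h _ (P.mem _ _ _ hne) rfl⟩

theorem trap (P : FwdScheme G12) (F : Set (Sym2 (Fin 14)))
    (S : Set (Fin 14 × Option (Fin 14)))
    (hFE : F ⊆ G12.edgeSet) (hF2 : F.ncard ≤ 2) (hc : (G12.deleteEdges F).Connected)
    (h0 : ((0 : Fin 14), (none : Option (Fin 14))) ∈ S)
    (hS : ∀ p ∈ S, Stay P F S p) : ¬ SrcDynResilient P (0 : Fin 14) (1 : Fin 14) 2 := by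
  intro hres
  have hch : ∀ p : Fin 14 × Option (Fin 14), ∃ f, f ⊆ F ∧ (p ∈ S → (Act f p.1).Nonempty ∧
      (P.fwd p.1 p.2 (Act f p.1), some p.1) ∈ S) := by
    intro p
    by_cases hp : p ∈ S
    · obtain ⟨_, f, hf, h⟩ := hS p hp
      exact ⟨f, hf, fun _ => h⟩
    · exact ⟨∅, Set.empty_subset _, fun h => absurd h hp⟩
  choose f hf hfS using hch
  let q : ℕ → Fin 14 × Option (Fin 14) := fun n =>
    Nat.rec (0, none) (fun _ p => (P.fwd p.1 p.2 (Act (f p) p.1), some p.1)) n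
  have hq : ∀ n, q (n+1) = (P.fwd (q n).1 (q n).2 (Act (f (q n)) (q n).1), some (q n).1) :=
    fun n => rfl
  have hqS : ∀ n, q n ∈ S := by
    intro n
    induction n with
    | zero => exact h0
    | succ n ih => rw [hq]; exact (hfS _ ih).2
  have ht : ∀ n, P.traj (fun n => f (q n)) 1 0 n = q n := by
    intro n
    induction n with
    | zero => rfl
    | succ n ih =>
      rw [FwdScheme.traj]
      simp only [ih]
      rw [if_neg (hS _ (hqS n)).1]
      exact (if_pos (hfS _ (hqS n)).1).trans (hq n).symm
  obtain ⟨n, hn⟩ := hres F hFE hF2 (hc.preconnected _ _) (fun n => f (q n)) (fun n => hf _)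
    (fun n => hc.preconnected _ _)
  rw [ht] at hn
  exact (hS _ (hqS n)).1 hn

/-- The edges of `G12` as a list. -/
def edges : List (Fin 14 × Fin 14) :=
  [(0, 2), (2, 3), (3, 4), (4, 5), (5, 6), (6, 3), (5, 7), (7, 1),
   (0, 8), (8, 9), (9, 10), (10, 11), (11, 12), (12, 9), (11, 13), (13, 1)]

/-- Computable adjacency. -/
def adjB (a b : Fin 14) : Bool := edges.elem (a, b) || edges.elem (b, a)

theorem edges_adj : ∀ d ∈ edges, G12.Adj d.1 d.2 := by
  intro d hd1
  simp only [edges, List.mem_cons, List.not_mem_nil, or_false] at hd1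
  rcases hd1 with rfl|rfl|rfl|rfl|rfl|rfl|rfl|rfl|rfl|rfl|rfl|rfl|rfl|rfl|rfl|rfl <;>
    simp [G12]

theorem adjB_iff (a b : Fin 14) : G12.Adj a b ↔ adjB a b = true := by
  constructor
  · intro h
    have h := h.1
    rcases h with h|h|h|h|h|h|h|h|h|h|h|h|h|h|h|h <;>
      (rcases Sym2.eq_iff.1 h with ⟨rfl, rfl⟩ | ⟨rfl, rfl⟩ <;> decide +kernel)
  · intro h
    rcases Bool.or_eq_true_iff.1 h with h | h
    · exact edges_adj _ (List.elem_iff.1 h)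
    · exact (edges_adj _ (List.elem_iff.1 h)).symm

theorem nb0 (u : Fin 14) : G12.Adj 0 u ↔ u = 2 ∨ u = 8 := by
  rw [adjB_iff]; revert u; decide +kernel

theorem nb2 (u : Fin 14) : G12.Adj 2 u ↔ u = 0 ∨ u = 3 := by
  rw [adjB_iff]; revert u; decide +kernel

theorem nb3 (u : Fin 14) : G12.Adj 3 u ↔ u = 2 ∨ u = 4 ∨ u = 6 := by
  rw [adjB_iff]; revert u; decide +kernel

theorem nb4 (u : Fin 14) : G12.Adj 4 u ↔ u = 3 ∨ u = 5 := by
  rw [adjB_iff]; revert u; decide +kernel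

theorem nb5 (u : Fin 14) : G12.Adj 5 u ↔ u = 4 ∨ u = 6 ∨ u = 7 := by
  rw [adjB_iff]; revert u; decide +kernel

theorem nb6 (u : Fin 14) : G12.Adj 6 u ↔ u = 3 ∨ u = 5 := by
  rw [adjB_iff]; revert u; decide +kernel

/-- Vertices found from `0` after `n` rounds of search. -/
def search (E : List (Fin 14 × Fin 14)) : ℕ → List (Fin 14)
  | 0 => [0]
  | n + 1 => E.foldl (fun L e => if L.elem e.1 then (if L.elem e.2 then L else e.2 :: L)
      else if L.elem e.2 then e.1 :: L else L) (search E n)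

theorem search_sound (H : SimpleGraph (Fin 14)) (E : List (Fin 14 × Fin 14))
    (hE : ∀ e ∈ E, H.Adj e.1 e.2) (n : ℕ) : ∀ v ∈ search E n, H.Reachable 0 v := by
  induction n with
  | zero => intro v hv; simp [search] at hv; subst hv; exact SimpleGraph.Reachable.refl _
  | succ n ih =>
    rw [search]
    generalize search E n = L at ih
    induction E generalizing L with
    | nil => simpa using ih
    | cons e E ihE =>
      rw [List.foldl_cons]
      apply ihE (fun e he => hE e (List.mem_cons_of_mem _ he))
      have he := hE e List.mem_cons_self
      intro v hv
      split_ifs at hv with h1 h2 h3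
      · exact ih v hv
      · rcases List.mem_cons.1 hv with rfl | hv
        · exact (ih _ (by simpa using h1)).trans he.reachable
        · exact ih v hv
      · rcases List.mem_cons.1 hv with rfl | hv
        · exact (ih _ (by simpa using h3)).trans he.symm.reachable
        · exact ih v hv
      · exact ih v hv

theorem conn_of_search (F : Set (Sym2 (Fin 14))) (E : List (Fin 14 × Fin 14))
    (hE : ∀ e ∈ E, G12.Adj e.1 e.2 ∧ s(e.1, e.2) ∉ F)
    (h : ∀ v, (search E 8).elem v = true) : (G12.deleteEdges F).Connected := by
  have h0 : ∀ v, (G12.deleteEdges F).Reachable 0 v := fun v =>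
    search_sound _ E (fun e he => by rw [SimpleGraph.deleteEdges_adj]; exact hE e he) 8 v
      (by simpa using h v)
  exact (SimpleGraph.connected_iff_exists_forall_reachable _).2 ⟨0, h0⟩

theorem edgeConn : EdgeConnected G12 2 := by
  intro F hF hc
  have hsub : F.Subsingleton := Set.ncard_le_one_iff_subsingleton.1 (by simpa using hc)
  have key : ∀ e ∈ edges, (G12.deleteEdges {s(e.1, e.2)}).Connected := by
    intro e he
    apply conn_of_search _ (edges.filter fun d => d != e)
    · intro d hd
      have hd' := List.mem_filter.1 hd
      obtain ⟨hd1, hd2⟩ := hd'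
      have hne : d ≠ e := by simpa using hd2
      constructor
      · exact edges_adj d hd1
      · have : ∀ d ∈ edges, ∀ e ∈ edges, d ≠ e → ¬ (d.1 = e.1 ∧ d.2 = e.2) ∧
            ¬ (d.1 = e.2 ∧ d.2 = e.1) := by decide +kernel
        have := this d hd1 e he hne
        rw [Set.mem_singleton_iff, Sym2.eq_iff]
        exact not_or.2 this
    · have : ∀ e ∈ edges, ∀ v, (search (edges.filter fun d => d != e) 8).elem v = true := by
        have hb : (edges.all fun e => (List.finRange 14).all fun v =>
            (search (edges.filter fun d => d != e) 8).elem v) = true := by decide +kernel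
        intro e he v
        exact List.all_eq_true.1 (List.all_eq_true.1 hb e he) v (List.mem_finRange v)
      exact this e he
  rcases hsub.eq_empty_or_singleton with rfl | ⟨e, rfl⟩
  · exact (key (0, 2) (by simp [edges])).mono (SimpleGraph.deleteEdges_anti (by simp))
  · have he : e ∈ G12.edgeSet := hF rfl
    have : ∃ d ∈ edges, e = s(d.1, d.2) := by
      simp only [G12, SimpleGraph.edgeSet_fromEdgeSet] at he
      have := he.1
      simpa [edges] using this
    obtain ⟨d, hd, rfl⟩ := this
    exact key d hd

theorem conn1 : (G12.deleteEdges {s(0, 8)}).Connected := by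
  apply conn_of_search _ (edges.filter fun d => d != (0, 8))
  · intro d hd
    simp [edges] at hd
    rcases hd with rfl|rfl|rfl|rfl|rfl|rfl|rfl|rfl|rfl|rfl|rfl|rfl|rfl|rfl|rfl <;> simp [G12]
  · decide +kernel

theorem conn2 : (G12.deleteEdges {s(0, 8), s(4, 5)}).Connected := by
  apply conn_of_search _ (edges.filter fun d => d != (0, 8) && d != (4, 5))
  · intro d hd
    simp [edges] at hd
    rcases hd with rfl|rfl|rfl|rfl|rfl|rfl|rfl|rfl|rfl|rfl|rfl|rfl|rfl|rfl <;> simp [G12]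
  · decide +kernel

theorem conn3 : (G12.deleteEdges {s(0, 8), s(3, 6)}).Connected := by
  apply conn_of_search _ (edges.filter fun d => d != (0, 8) && d != (6, 3))
  · intro d hd
    simp [edges] at hd
    rcases hd with rfl|rfl|rfl|rfl|rfl|rfl|rfl|rfl|rfl|rfl|rfl|rfl|rfl|rfl <;> simp [G12]
  · decide +kernel

theorem conn4 : (G12.deleteEdges {s(5, 7), s(3, 6)}).Connected := by
  apply conn_of_search _ (edges.filter fun d => d != (5, 7) && d != (6, 3))
  · intro d hd
    simp [edges] at hd
    rcases hd with rfl|rfl|rfl|rfl|rfl|rfl|rfl|rfl|rfl|rfl|rfl|rfl|rfl|rfl <;> simp [G12]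
  · decide +kernel

theorem fact1 (P : FwdScheme G12)
    (hres : SrcDynResilient P (0 : Fin 14) (1 : Fin 14) 2) :
    P.fwd 2 (some 0) {0, 3} = 3 := by
  by_contra h
  refine trap P {s(0, 8)}
    {(0, none), (2, some 0), (0, some 2)} ?_ ?_ ?_ (by simp) ?_ hres
  · intro e he; simp only [Set.mem_insert_iff, Set.mem_singleton_iff] at he
    rcases he with rfl <;> simp [G12]
  · simp
  · exact conn1
  · intro p hp; simp only [Set.mem_insert_iff, Set.mem_singleton_iff] at hp
    rcases hp with rfl|rfl|rfl
    · refine Stay.mk' {s(0, 8)} {2} (by decide) (by simp) ?_ (by simp) ?_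
      · ext u; first | (rw [mem_act, nb0]; constructor <;> [rintro ⟨rfl|rfl, h⟩; rintro (rfl)] <;> simp_all; done)
      · intro w hw e; simp only [Set.mem_insert_iff, Set.mem_singleton_iff] at hw ⊢; grind
    · refine Stay.mk' {s(0, 8)} {0, 3} (by decide) (by simp) ?_ (by simp) ?_
      · ext u; first | (rw [mem_act, nb2]; constructor <;> [rintro ⟨rfl|rfl, h⟩; rintro (rfl|rfl)] <;> simp_all; done)
      · intro w hw e; simp only [Set.mem_insert_iff, Set.mem_singleton_iff] at hw ⊢; grind
    · refine Stay.mk' {s(0, 8)} {2} (by decide) (by simp) ?_ (by simp) ?_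
      · ext u; first | (rw [mem_act, nb0]; constructor <;> [rintro ⟨rfl|rfl, h⟩; rintro (rfl)] <;> simp_all; done)
      · intro w hw e; simp only [Set.mem_insert_iff, Set.mem_singleton_iff] at hw ⊢; grind

theorem fact2 (P : FwdScheme G12)
    (hres : SrcDynResilient P (0 : Fin 14) (1 : Fin 14) 2) :
    P.fwd 3 (some 2) {2, 4, 6} ≠ 2 := by
  have h1 := fact1 P hres
  intro h
  refine trap P {s(0, 8)}
    {(0, none), (2, some 0), (0, some 2), (3, some 2), (2, some 3)} ?_ ?_ ?_ (by simp) ?_ hres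
  · intro e he; simp only [Set.mem_insert_iff, Set.mem_singleton_iff] at he
    rcases he with rfl <;> simp [G12]
  · simp
  · exact conn1
  · intro p hp; simp only [Set.mem_insert_iff, Set.mem_singleton_iff] at hp
    rcases hp with rfl|rfl|rfl|rfl|rfl
    · refine Stay.mk' {s(0, 8)} {2} (by decide) (by simp) ?_ (by simp) ?_
      · ext u; first | (rw [mem_act, nb0]; constructor <;> [rintro ⟨rfl|rfl, h⟩; rintro (rfl)] <;> simp_all; done)
      · intro w hw e; simp only [Set.mem_insert_iff, Set.mem_singleton_iff] at hw ⊢; grind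
    · refine Stay.mk' {s(0, 8)} {0, 3} (by decide) (by simp) ?_ (by simp) ?_
      · ext u; first | (rw [mem_act, nb2]; constructor <;> [rintro ⟨rfl|rfl, h⟩; rintro (rfl|rfl)] <;> simp_all; done)
      · intro w hw e; simp only [Set.mem_insert_iff, Set.mem_singleton_iff] at hw ⊢; grind
    · refine Stay.mk' {s(0, 8)} {2} (by decide) (by simp) ?_ (by simp) ?_
      · ext u; first | (rw [mem_act, nb0]; constructor <;> [rintro ⟨rfl|rfl, h⟩; rintro (rfl)] <;> simp_all; done)
      · intro w hw e; simp only [Set.mem_insert_iff, Set.mem_singleton_iff] at hw ⊢; grind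
    · refine Stay.mk' {s(0, 8)} {2, 4, 6} (by decide) (by simp) ?_ (by simp) ?_
      · ext u; first | (rw [mem_act, nb3]; constructor <;> [rintro ⟨rfl|rfl|rfl, h⟩; rintro (rfl|rfl|rfl)] <;> simp_all; done)
      · intro w hw e; simp only [Set.mem_insert_iff, Set.mem_singleton_iff] at hw ⊢; grind
    · refine Stay.mk' {s(0, 8)} {0, 3} (by decide) (by simp) ?_ (by simp) ?_
      · ext u; first | (rw [mem_act, nb2]; constructor <;> [rintro ⟨rfl|rfl, h⟩; rintro (rfl|rfl)] <;> simp_all; done)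
      · intro w hw e; simp only [Set.mem_insert_iff, Set.mem_singleton_iff] at hw ⊢; grind

theorem fact3 (P : FwdScheme G12)
    (hres : SrcDynResilient P (0 : Fin 14) (1 : Fin 14) 2)
    (h2 : P.fwd 3 (some 2) {2, 4, 6} = 4) : P.fwd 3 (some 4) {2, 4, 6} = 6 := by
  have h1 := fact1 P hres
  by_contra h
  refine trap P {s(0, 8), s(4, 5)}
    {(0, none), (2, some 0), (0, some 2), (3, some 2), (2, some 3), (4, some 3), (3, some 4)} ?_ ?_ ?_ (by simp) ?_ hres
  · intro e he; simp only [Set.mem_insert_iff, Set.mem_singleton_iff] at he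
    rcases he with rfl|rfl <;> simp [G12]
  · exact (Set.ncard_insert_le _ _).trans (by simp)
  · exact conn2
  · intro p hp; simp only [Set.mem_insert_iff, Set.mem_singleton_iff] at hp
    rcases hp with rfl|rfl|rfl|rfl|rfl|rfl|rfl
    · refine Stay.mk' {s(0, 8), s(4, 5)} {2} (by decide) (by simp) ?_ (by simp) ?_
      · ext u; first | (rw [mem_act, nb0]; constructor <;> [rintro ⟨rfl|rfl, h⟩; rintro (rfl)] <;> simp_all; done)
      · intro w hw e; simp only [Set.mem_insert_iff, Set.mem_singleton_iff] at hw ⊢; grind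
    · refine Stay.mk' {s(0, 8), s(4, 5)} {0, 3} (by decide) (by simp) ?_ (by simp) ?_
      · ext u; first | (rw [mem_act, nb2]; constructor <;> [rintro ⟨rfl|rfl, h⟩; rintro (rfl|rfl)] <;> simp_all; done)
      · intro w hw e; simp only [Set.mem_insert_iff, Set.mem_singleton_iff] at hw ⊢; grind
    · refine Stay.mk' {s(0, 8), s(4, 5)} {2} (by decide) (by simp) ?_ (by simp) ?_
      · ext u; first | (rw [mem_act, nb0]; constructor <;> [rintro ⟨rfl|rfl, h⟩; rintro (rfl)] <;> simp_all; done)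
      · intro w hw e; simp only [Set.mem_insert_iff, Set.mem_singleton_iff] at hw ⊢; grind
    · refine Stay.mk' {s(0, 8), s(4, 5)} {2, 4, 6} (by decide) (by simp) ?_ (by simp) ?_
      · ext u; first | (rw [mem_act, nb3]; constructor <;> [rintro ⟨rfl|rfl|rfl, h⟩; rintro (rfl|rfl|rfl)] <;> simp_all; done)
      · intro w hw e; simp only [Set.mem_insert_iff, Set.mem_singleton_iff] at hw ⊢; grind
    · refine Stay.mk' {s(0, 8), s(4, 5)} {0, 3} (by decide) (by simp) ?_ (by simp) ?_
      · ext u; first | (rw [mem_act, nb2]; constructor <;> [rintro ⟨rfl|rfl, h⟩; rintro (rfl|rfl)] <;> simp_all; done)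
      · intro w hw e; simp only [Set.mem_insert_iff, Set.mem_singleton_iff] at hw ⊢; grind
    · refine Stay.mk' {s(0, 8), s(4, 5)} {3} (by decide) (by simp) ?_ (by simp) ?_
      · ext u; first | (rw [mem_act, nb4]; constructor <;> [rintro ⟨rfl|rfl, h⟩; rintro (rfl)] <;> simp_all; done)
      · intro w hw e; simp only [Set.mem_insert_iff, Set.mem_singleton_iff] at hw ⊢; grind
    · refine Stay.mk' {s(0, 8), s(4, 5)} {2, 4, 6} (by decide) (by simp) ?_ (by simp) ?_
      · ext u; first | (rw [mem_act, nb3]; constructor <;> [rintro ⟨rfl|rfl|rfl, h⟩; rintro (rfl|rfl|rfl)] <;> simp_all; done)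
      · intro w hw e; simp only [Set.mem_insert_iff, Set.mem_singleton_iff] at hw ⊢; grind

theorem fact4 (P : FwdScheme G12)
    (hres : SrcDynResilient P (0 : Fin 14) (1 : Fin 14) 2)
    (h2 : P.fwd 3 (some 2) {2, 4, 6} = 4) : P.fwd 4 (some 3) {3, 5} = 5 := by
  have h1 := fact1 P hres
  by_contra h
  refine trap P {s(0, 8), s(3, 6)}
    {(0, none), (2, some 0), (0, some 2), (3, some 2), (2, some 3), (4, some 3), (3, some 4)} ?_ ?_ ?_ (by simp) ?_ hres
  · intro e he; simp only [Set.mem_insert_iff, Set.mem_singleton_iff] at he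
    rcases he with rfl|rfl <;> simp [G12]
  · exact (Set.ncard_insert_le _ _).trans (by simp)
  · exact conn3
  · intro p hp; simp only [Set.mem_insert_iff, Set.mem_singleton_iff] at hp
    rcases hp with rfl|rfl|rfl|rfl|rfl|rfl|rfl
    · refine Stay.mk' {s(0, 8), s(3, 6)} {2} (by decide) (by simp) ?_ (by simp) ?_
      · ext u; first | (rw [mem_act, nb0]; constructor <;> [rintro ⟨rfl|rfl, h⟩; rintro (rfl)] <;> simp_all; done)
      · intro w hw e; simp only [Set.mem_insert_iff, Set.mem_singleton_iff] at hw ⊢; grind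
    · refine Stay.mk' {s(0, 8), s(3, 6)} {0, 3} (by decide) (by simp) ?_ (by simp) ?_
      · ext u; first | (rw [mem_act, nb2]; constructor <;> [rintro ⟨rfl|rfl, h⟩; rintro (rfl|rfl)] <;> simp_all; done)
      · intro w hw e; simp only [Set.mem_insert_iff, Set.mem_singleton_iff] at hw ⊢; grind
    · refine Stay.mk' {s(0, 8), s(3, 6)} {2} (by decide) (by simp) ?_ (by simp) ?_
      · ext u; first | (rw [mem_act, nb0]; constructor <;> [rintro ⟨rfl|rfl, h⟩; rintro (rfl)] <;> simp_all; done)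
      · intro w hw e; simp only [Set.mem_insert_iff, Set.mem_singleton_iff] at hw ⊢; grind
    · refine Stay.mk' ∅ {2, 4, 6} (by decide) (by simp) ?_ (by simp) ?_
      · ext u; first | (rw [mem_act, nb3]; constructor <;> [rintro ⟨rfl|rfl|rfl, h⟩; rintro (rfl|rfl|rfl)] <;> simp_all; done)
      · intro w hw e; simp only [Set.mem_insert_iff, Set.mem_singleton_iff] at hw ⊢; grind
    · refine Stay.mk' {s(0, 8), s(3, 6)} {0, 3} (by decide) (by simp) ?_ (by simp) ?_
      · ext u; first | (rw [mem_act, nb2]; constructor <;> [rintro ⟨rfl|rfl, h⟩; rintro (rfl|rfl)] <;> simp_all; done)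
      · intro w hw e; simp only [Set.mem_insert_iff, Set.mem_singleton_iff] at hw ⊢; grind
    · refine Stay.mk' {s(0, 8), s(3, 6)} {3, 5} (by decide) (by simp) ?_ (by simp) ?_
      · ext u; first | (rw [mem_act, nb4]; constructor <;> [rintro ⟨rfl|rfl, h⟩; rintro (rfl|rfl)] <;> simp_all; done)
      · intro w hw e; simp only [Set.mem_insert_iff, Set.mem_singleton_iff] at hw ⊢; grind
    · refine Stay.mk' {s(0, 8), s(3, 6)} {2, 4} (by decide) (by simp) ?_ (by simp) ?_
      · ext u; first | (rw [mem_act, nb3]; constructor <;> [rintro ⟨rfl|rfl|rfl, h⟩; rintro (rfl|rfl)] <;> simp_all; done)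
      · intro w hw e; simp only [Set.mem_insert_iff, Set.mem_singleton_iff] at hw ⊢; grind

theorem fact5 (P : FwdScheme G12)
    (hres : SrcDynResilient P (0 : Fin 14) (1 : Fin 14) 2)
    (h2 : P.fwd 3 (some 2) {2, 4, 6} = 4) : P.fwd 6 (some 3) {3, 5} = 5 := by
  have h1 := fact1 P hres
  have h3 := fact3 P hres h2
  by_contra h
  refine trap P {s(0, 8), s(4, 5)}
    {(0, none), (2, some 0), (0, some 2), (3, some 2), (2, some 3), (4, some 3), (3, some 4), (6, some 3), (3, some 6)} ?_ ?_ ?_ (by simp) ?_ hres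
  · intro e he; simp only [Set.mem_insert_iff, Set.mem_singleton_iff] at he
    rcases he with rfl|rfl <;> simp [G12]
  · exact (Set.ncard_insert_le _ _).trans (by simp)
  · exact conn2
  · intro p hp; simp only [Set.mem_insert_iff, Set.mem_singleton_iff] at hp
    rcases hp with rfl|rfl|rfl|rfl|rfl|rfl|rfl|rfl|rfl
    · refine Stay.mk' {s(0, 8), s(4, 5)} {2} (by decide) (by simp) ?_ (by simp) ?_
      · ext u; first | (rw [mem_act, nb0]; constructor <;> [rintro ⟨rfl|rfl, h⟩; rintro (rfl)] <;> simp_all; done)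
      · intro w hw e; simp only [Set.mem_insert_iff, Set.mem_singleton_iff] at hw ⊢; grind
    · refine Stay.mk' {s(0, 8), s(4, 5)} {0, 3} (by decide) (by simp) ?_ (by simp) ?_
      · ext u; first | (rw [mem_act, nb2]; constructor <;> [rintro ⟨rfl|rfl, h⟩; rintro (rfl|rfl)] <;> simp_all; done)
      · intro w hw e; simp only [Set.mem_insert_iff, Set.mem_singleton_iff] at hw ⊢; grind
    · refine Stay.mk' {s(0, 8), s(4, 5)} {2} (by decide) (by simp) ?_ (by simp) ?_
      · ext u; first | (rw [mem_act, nb0]; constructor <;> [rintro ⟨rfl|rfl, h⟩; rintro (rfl)] <;> simp_all; done)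
      · intro w hw e; simp only [Set.mem_insert_iff, Set.mem_singleton_iff] at hw ⊢; grind
    · refine Stay.mk' {s(0, 8), s(4, 5)} {2, 4, 6} (by decide) (by simp) ?_ (by simp) ?_
      · ext u; first | (rw [mem_act, nb3]; constructor <;> [rintro ⟨rfl|rfl|rfl, h⟩; rintro (rfl|rfl|rfl)] <;> simp_all; done)
      · intro w hw e; simp only [Set.mem_insert_iff, Set.mem_singleton_iff] at hw ⊢; grind
    · refine Stay.mk' {s(0, 8), s(4, 5)} {0, 3} (by decide) (by simp) ?_ (by simp) ?_
      · ext u; first | (rw [mem_act, nb2]; constructor <;> [rintro ⟨rfl|rfl, h⟩; rintro (rfl|rfl)] <;> simp_all; done)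
      · intro w hw e; simp only [Set.mem_insert_iff, Set.mem_singleton_iff] at hw ⊢; grind
    · refine Stay.mk' {s(0, 8), s(4, 5)} {3} (by decide) (by simp) ?_ (by simp) ?_
      · ext u; first | (rw [mem_act, nb4]; constructor <;> [rintro ⟨rfl|rfl, h⟩; rintro (rfl)] <;> simp_all; done)
      · intro w hw e; simp only [Set.mem_insert_iff, Set.mem_singleton_iff] at hw ⊢; grind
    · refine Stay.mk' {s(0, 8), s(4, 5)} {2, 4, 6} (by decide) (by simp) ?_ (by simp) ?_
      · ext u; first | (rw [mem_act, nb3]; constructor <;> [rintro ⟨rfl|rfl|rfl, h⟩; rintro (rfl|rfl|rfl)] <;> simp_all; done)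
      · intro w hw e; simp only [Set.mem_insert_iff, Set.mem_singleton_iff] at hw ⊢; grind
    · refine Stay.mk' {s(0, 8), s(4, 5)} {3, 5} (by decide) (by simp) ?_ (by simp) ?_
      · ext u; first | (rw [mem_act, nb6]; constructor <;> [rintro ⟨rfl|rfl, h⟩; rintro (rfl|rfl)] <;> simp_all; done)
      · intro w hw e; simp only [Set.mem_insert_iff, Set.mem_singleton_iff] at hw ⊢; grind
    · refine Stay.mk' {s(0, 8), s(4, 5)} {2, 4, 6} (by decide) (by simp) ?_ (by simp) ?_
      · ext u; first | (rw [mem_act, nb3]; constructor <;> [rintro ⟨rfl|rfl|rfl, h⟩; rintro (rfl|rfl|rfl)] <;> simp_all; done)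
      · intro w hw e; simp only [Set.mem_insert_iff, Set.mem_singleton_iff] at hw ⊢; grind

theorem core (P : FwdScheme G12)
    (hres : SrcDynResilient P (0 : Fin 14) (1 : Fin 14) 2)
    (h0 : P.fwd 0 none {2, 8} = 2) (h2 : P.fwd 3 (some 2) {2, 4, 6} = 4) : False := by
  have h1 := fact1 P hres
  have h3 := fact3 P hres h2
  have h4 := fact4 P hres h2
  have h5 := fact5 P hres h2
  refine trap P {s(5, 7), s(3, 6)}
    {(0, none), (2, some 0), (3, some 2), (4, some 3), (5, some 4), (4, some 5), (6, some 5), (5, some 6), (3, some 4), (6, some 3)} ?_ ?_ ?_ (by simp) ?_ hres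
  · intro e he; simp only [Set.mem_insert_iff, Set.mem_singleton_iff] at he
    rcases he with rfl|rfl <;> simp [G12]
  · exact (Set.ncard_insert_le _ _).trans (by simp)
  · exact conn4
  · intro p hp; simp only [Set.mem_insert_iff, Set.mem_singleton_iff] at hp
    rcases hp with rfl|rfl|rfl|rfl|rfl|rfl|rfl|rfl|rfl|rfl
    · refine Stay.mk' {s(5, 7), s(3, 6)} {2, 8} (by decide) (by simp) ?_ (by simp) ?_
      · ext u; first | (rw [mem_act, nb0]; constructor <;> [rintro ⟨rfl|rfl, h⟩; rintro (rfl|rfl)] <;> simp_all; done)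
      · intro w hw e; simp only [Set.mem_insert_iff, Set.mem_singleton_iff] at hw ⊢; grind
    · refine Stay.mk' {s(5, 7), s(3, 6)} {0, 3} (by decide) (by simp) ?_ (by simp) ?_
      · ext u; first | (rw [mem_act, nb2]; constructor <;> [rintro ⟨rfl|rfl, h⟩; rintro (rfl|rfl)] <;> simp_all; done)
      · intro w hw e; simp only [Set.mem_insert_iff, Set.mem_singleton_iff] at hw ⊢; grind
    · refine Stay.mk' {s(5, 7)} {2, 4, 6} (by decide) (by simp) ?_ (by simp) ?_
      · ext u; first | (rw [mem_act, nb3]; constructor <;> [rintro ⟨rfl|rfl|rfl, h⟩; rintro (rfl|rfl|rfl)] <;> simp_all; done)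
      · intro w hw e; simp only [Set.mem_insert_iff, Set.mem_singleton_iff] at hw ⊢; grind
    · refine Stay.mk' {s(5, 7), s(3, 6)} {3, 5} (by decide) (by simp) ?_ (by simp) ?_
      · ext u; first | (rw [mem_act, nb4]; constructor <;> [rintro ⟨rfl|rfl, h⟩; rintro (rfl|rfl)] <;> simp_all; done)
      · intro w hw e; simp only [Set.mem_insert_iff, Set.mem_singleton_iff] at hw ⊢; grind
    · refine Stay.mk' {s(5, 7), s(3, 6)} {4, 6} (by decide) (by simp) ?_ (by simp) ?_
      · ext u; first | (rw [mem_act, nb5]; constructor <;> [rintro ⟨rfl|rfl|rfl, h⟩; rintro (rfl|rfl)] <;> simp_all; done)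
      · intro w hw e; simp only [Set.mem_insert_iff, Set.mem_singleton_iff] at hw ⊢; grind
    · refine Stay.mk' {s(5, 7), s(3, 6)} {3, 5} (by decide) (by simp) ?_ (by simp) ?_
      · ext u; first | (rw [mem_act, nb4]; constructor <;> [rintro ⟨rfl|rfl, h⟩; rintro (rfl|rfl)] <;> simp_all; done)
      · intro w hw e; simp only [Set.mem_insert_iff, Set.mem_singleton_iff] at hw ⊢; grind
    · refine Stay.mk' {s(5, 7), s(3, 6)} {5} (by decide) (by simp) ?_ (by simp) ?_
      · ext u; first | (rw [mem_act, nb6]; constructor <;> [rintro ⟨rfl|rfl, h⟩; rintro (rfl)] <;> simp_all; done)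
      · intro w hw e; simp only [Set.mem_insert_iff, Set.mem_singleton_iff] at hw ⊢; grind
    · refine Stay.mk' {s(5, 7), s(3, 6)} {4, 6} (by decide) (by simp) ?_ (by simp) ?_
      · ext u; first | (rw [mem_act, nb5]; constructor <;> [rintro ⟨rfl|rfl|rfl, h⟩; rintro (rfl|rfl)] <;> simp_all; done)
      · intro w hw e; simp only [Set.mem_insert_iff, Set.mem_singleton_iff] at hw ⊢; grind
    · refine Stay.mk' {s(5, 7)} {2, 4, 6} (by decide) (by simp) ?_ (by simp) ?_
      · ext u; first | (rw [mem_act, nb3]; constructor <;> [rintro ⟨rfl|rfl|rfl, h⟩; rintro (rfl|rfl|rfl)] <;> simp_all; done)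
      · intro w hw e; simp only [Set.mem_insert_iff, Set.mem_singleton_iff] at hw ⊢; grind
    · refine Stay.mk' {s(5, 7)} {3, 5} (by decide) (by simp) ?_ (by simp) ?_
      · ext u; first | (rw [mem_act, nb4]; constructor <;> [rintro ⟨rfl|rfl, h⟩; rintro (rfl|rfl)] <;> simp_all; done) | (rw [mem_act, nb6]; constructor <;> [rintro ⟨rfl|rfl, h⟩; rintro (rfl|rfl)] <;> simp_all; done)
      · intro w hw e; simp only [Set.mem_insert_iff, Set.mem_singleton_iff] at hw ⊢; grind

/-- The scheme `P` seen through an automorphism. -/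
def conj (P : FwdScheme G12) (φ : Equiv.Perm (Fin 14)) : FwdScheme G12 where
  fwd v ip A := φ.symm (P.fwd (φ v) (ip.map φ) (φ '' A))
  mem v ip A hA := by
    have := P.mem (φ v) (ip.map φ) (φ '' A) (hA.image _)
    obtain ⟨a, ha, h⟩ := this
    rw [← h]; simpa using ha

theorem conj_res (P : FwdScheme G12) (φ : Equiv.Perm (Fin 14))
    (hφ : ∀ a b, G12.Adj (φ a) (φ b) ↔ G12.Adj a b) (h0 : φ 0 = 0) (h1 : φ 1 = 1)
    (hres : SrcDynResilient P (0 : Fin 14) (1 : Fin 14) 2) :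
    SrcDynResilient (conj P φ) (0 : Fin 14) (1 : Fin 14) 2 := by
  intro F hFE hF2 hst σ hσ hnt
  have hinj : Function.Injective (Sym2.map φ) := Sym2.map.injective φ.injective
  have hadj : ∀ a b, (G12.deleteEdges (Sym2.map φ '' F)).Adj (φ a) (φ b) ↔
      (G12.deleteEdges F).Adj a b := by
    intro a b
    rw [SimpleGraph.deleteEdges_adj, SimpleGraph.deleteEdges_adj, hφ, ← Sym2.map_mk,
      hinj.mem_set_image]
  let hom : G12.deleteEdges F →g G12.deleteEdges (Sym2.map φ '' F) :=
    ⟨φ, fun {a b} h => (hadj a b).2 h⟩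
  have hreach : ∀ a b, (G12.deleteEdges F).Reachable a b →
      (G12.deleteEdges (Sym2.map φ '' F)).Reachable (φ a) (φ b) :=
    fun a b h => h.map hom
  have htr : ∀ n, P.traj (fun n => Sym2.map φ '' σ n) 1 0 n =
      (φ ((conj P φ).traj σ 1 0 n).1, ((conj P φ).traj σ 1 0 n).2.map φ) := by
    intro n
    induction n with
    | zero => simp [FwdScheme.traj, h0]
    | succ n ih =>
      rw [FwdScheme.traj, FwdScheme.traj]
      simp only [ih]
      generalize (conj P φ).traj σ 1 0 n = p
      have hA : {u | G12.Adj (φ p.1) u ∧ s(φ p.1, u) ∉ Sym2.map φ '' σ n} =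
          φ '' {u | G12.Adj p.1 u ∧ s(p.1, u) ∉ σ n} := by
        ext u
        obtain ⟨u, rfl⟩ := φ.surjective u
        rw [φ.injective.mem_set_image]
        simp only [Set.mem_setOf_eq]
        rw [hφ, ← Sym2.map_mk, hinj.mem_set_image]
      have ht : φ p.1 = 1 ↔ p.1 = 1 := by
        rw [← φ.injective.eq_iff (a := p.1), h1]
      rw [hA]
      simp only [ht, Set.image_nonempty]
      split_ifs <;> simp [conj]
  obtain ⟨n, hn⟩ := hres (Sym2.map φ '' F) (by
      rintro _ ⟨e, he, rfl⟩
      have := hFE he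
      induction e with
      | _ a b => exact (hφ a b).2 this)
    ((Set.ncard_image_le (Set.toFinite _)).trans hF2)
    (by simpa [h0, h1] using hreach _ _ hst) (fun n => Sym2.map φ '' σ n)
    (fun n => Set.image_mono (hσ n)) (fun n => by
      rw [htr, htr]; exact hreach _ _ (hnt n))
  refine ⟨n, ?_⟩
  rw [htr] at hn
  apply φ.injective
  rw [h1]; exact hn

/-- Exchange of `v₂` and `v₄`. -/
def rot : Equiv.Perm (Fin 14) := Equiv.swap 4 6

/-- Exchange of the two sides. -/
def flip : Equiv.Perm (Fin 14) where
  toFun := ![0, 1, 8, 9, 10, 11, 12, 13, 2, 3, 4, 5, 6, 7]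
  invFun := ![0, 1, 8, 9, 10, 11, 12, 13, 2, 3, 4, 5, 6, 7]
  left_inv := by intro x; revert x; decide
  right_inv := by intro x; revert x; decide

theorem rot_adj (a b : Fin 14) : G12.Adj (rot a) (rot b) ↔ G12.Adj a b := by
  have : ∀ a b, adjB (rot a) (rot b) = adjB a b := by decide +kernel
  rw [adjB_iff, adjB_iff, this]

theorem flip_adj (a b : Fin 14) : G12.Adj (flip a) (flip b) ↔ G12.Adj a b := by
  have : ∀ a b, adjB (flip a) (flip b) = adjB a b := by decide +kernel
  rw [adjB_iff, adjB_iff, this]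

theorem core2 (P : FwdScheme G12) (hres : SrcDynResilient P (0 : Fin 14) (1 : Fin 14) 2)
    (h0 : P.fwd 0 none {2, 8} = 2) : False := by
  have hm := P.mem 3 (some 2) {2, 4, 6} (by simp)
  have h2 := fact2 P hres
  rcases hm with h | h | h
  · exact h2 h
  · exact core P hres h0 h
  · have h' : P.fwd 3 (some 2) {2, 4, 6} = 6 := h
    refine core (conj P rot) (conj_res P rot rot_adj (by decide) (by decide) hres) ?_ ?_
    · have e : rot '' {2, 8} = {2, 8} := by
        rw [Set.image_pair]; rfl
      change rot.symm (P.fwd (rot 0) none (rot '' {2, 8})) = 2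
      rw [e, show rot 0 = 0 by decide, h0]; decide
    · have e : rot '' {2, 4, 6} = {2, 4, 6} := by
        rw [Set.image_insert_eq, Set.image_pair, show rot 2 = 2 by decide,
          show rot 4 = 6 by decide, show rot 6 = 4 by decide, Set.pair_comm]
      change rot.symm (P.fwd (rot 3) (some (rot 2)) (rot '' {2, 4, 6})) = 4
      rw [e, show rot 3 = 3 by decide, show rot 2 = 2 by decide, h']; decide

theorem no_scheme (P : FwdScheme G12) : ¬ SrcDynResilient P (0 : Fin 14) (1 : Fin 14) 2 := by
  intro hres
  rcases P.mem 0 none {2, 8} (by simp) with h | h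
  · exact core2 P hres h
  · have h' : P.fwd 0 none {2, 8} = 8 := h
    refine core2 (conj P flip) (conj_res P flip flip_adj (by decide) (by decide) hres) ?_
    have e : flip '' {2, 8} = {2, 8} := by
      rw [Set.image_pair, show flip 2 = 8 by decide, show flip 8 = 2 by decide, Set.pair_comm]
    change flip.symm (P.fwd (flip 0) none (flip '' {2, 8})) = 2
    rw [e, show flip 0 = 0 by decide, h']; decide

/-- Theorem (no 2-resilience against dynamic failures): the graph `G12` is
2-edge-connected (and planar), yet no source-matched forwarding scheme for
`(s, t) = (0, 1)` on `G12` (without rewriting bits in packet headers) is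
2-resilient against dynamic failures. -/
theorem no_two_resilient_source_matched_dynamic :
    EdgeConnected G12 2 ∧
    ∀ P : FwdScheme G12, ¬ SrcDynResilient P (0 : Fin 14) (1 : Fin 14) 2 := by
  exact ⟨edgeConn, no_scheme⟩

end FRR
end
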